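/- For every integer m ≥ 2 there is an open and dense subset U of ℝ³ such that for every parameter triple (α, β, ρ) ∈ U, the bifurcation system (B) for the (m:1) resonance has at least one simple solution (e, ℓ, g) ∈ (0,1) × [0,2π) × [0,2π). -/

import Mathlib

open Real Set

/-- Bessel function of integer order `n`. -/
noncomputable def besselJ (n : ℤ) (x : ℝ) : ℝ :=
  (1 / (2 * π)) * ∫ t in (0:ℝ)..(2 * π), Real.cos (n * t - x * Real.sin t)

/-- Derivative of the Bessel function with respect to its argument. -/
noncomputable def besselJd (n : ℤ) (x : ℝ) : ℝ := deriv (besselJ n) x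

/-- The Fourier coefficient `A_m(e)`. -/
noncomputable def coefA (m : ℕ) (e : ℝ) : ℝ :=
  (4 / ((m:ℝ) ^ 2 * e ^ 2)) *
    (2 * m * e * (1 - e ^ 2) * besselJd m (m * e) - (2 - e ^ 2) * besselJ m (m * e))

/-- The Fourier coefficient `B_m(e)`. -/
noncomputable def coefB (m : ℕ) (e : ℝ) : ℝ :=
  -(8 / ((m:ℝ) ^ 2 * e ^ 2)) * Real.sqrt (1 - e ^ 2) *
    (e * besselJd m (m * e) - m * (1 - e ^ 2) * besselJ m (m * e))

/-- `𝓔 = √(α²+β²+2αβ sin ρ)`. -/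
noncomputable def calE (α β ρ : ℝ) : ℝ := Real.sqrt (α ^ 2 + β ^ 2 + 2 * α * β * Real.sin ρ)

/-- `𝓕 = √(α²+β²−2αβ sin ρ)`. -/
noncomputable def calF (α β ρ : ℝ) : ℝ := Real.sqrt (α ^ 2 + β ^ 2 - 2 * α * β * Real.sin ρ)

/-- First equation of the bifurcation system (B): `𝓕(A_m+B_m)cos(2g+mℓ+τ)`. -/
noncomputable def bifF1 (m : ℕ) (α β ρ τ : ℝ) (e ℓ g : ℝ) : ℝ :=
  calF α β ρ * (coefA m e + coefB m e) * Real.cos (2 * g + m * ℓ + τ)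

/-- Second equation of the bifurcation system (B): `𝓔(A_m−B_m)cos(2g−mℓ+σ)`. -/
noncomputable def bifF2 (m : ℕ) (α β ρ σ : ℝ) (e ℓ g : ℝ) : ℝ :=
  calE α β ρ * (coefA m e - coefB m e) * Real.cos (2 * g - m * ℓ + σ)

/-- Third equation of the bifurcation system (B):
`(A_m'+B_m')𝓕 sin(2g+mℓ+τ) + (A_m'−B_m')𝓔 sin(2g−mℓ+σ)`. -/
noncomputable def bifF3 (m : ℕ) (α β ρ σ τ : ℝ) (e ℓ g : ℝ) : ℝ :=
  (deriv (coefA m) e + deriv (coefB m) e) * calF α β ρ * Real.sin (2 * g + m * ℓ + τ) +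
  (deriv (coefA m) e - deriv (coefB m) e) * calE α β ρ * Real.sin (2 * g - m * ℓ + σ)

/-- The solution set of the bifurcation system (B) for the `(m:1)` resonance, in the
unknowns `(e, ℓ, g) ∈ (0,1) × [0,2π) × [0,2π)`. -/
noncomputable def bifSolSet (m : ℕ) (α β ρ σ τ : ℝ) : Set (ℝ × ℝ × ℝ) :=
  {p | p.1 ∈ Set.Ioo (0:ℝ) 1 ∧ p.2.1 ∈ Set.Ico (0:ℝ) (2 * π) ∧
       p.2.2 ∈ Set.Ico (0:ℝ) (2 * π) ∧
       bifF1 m α β ρ τ p.1 p.2.1 p.2.2 = 0 ∧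
       bifF2 m α β ρ σ p.1 p.2.1 p.2.2 = 0 ∧
       bifF3 m α β ρ σ τ p.1 p.2.1 p.2.2 = 0}

/-- Jacobian determinant of the three left-hand sides of system (B) with respect to
`(e, ℓ, g)`; a solution is simple when this is nonzero. -/
noncomputable def bifJac (m : ℕ) (α β ρ σ τ : ℝ) (e ℓ g : ℝ) : ℝ :=
  Matrix.det
    !![deriv (fun x => bifF1 m α β ρ τ x ℓ g) e,
       deriv (fun x => bifF1 m α β ρ τ e x g) ℓ,
       deriv (fun x => bifF1 m α β ρ τ e ℓ x) g;
       deriv (fun x => bifF2 m α β ρ σ x ℓ g) e,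
       deriv (fun x => bifF2 m α β ρ σ e x g) ℓ,
       deriv (fun x => bifF2 m α β ρ σ e ℓ x) g;
       deriv (fun x => bifF3 m α β ρ σ τ x ℓ g) e,
       deriv (fun x => bifF3 m α β ρ σ τ e x g) ℓ,
       deriv (fun x => bifF3 m α β ρ σ τ e ℓ x) g]


lemma bes_cont (n : ℤ) (x : ℝ) : Continuous (fun t : ℝ => Real.cos (n * t - x * Real.sin t)) := by
  fun_prop

lemma bes_hasDerivAt (n : ℤ) (x : ℝ) :
    HasDerivAt (besselJ n) ((besselJ (n - 1) x - besselJ (n + 1) x) / 2) x := by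
  have key := (intervalIntegral.hasDerivAt_integral_of_dominated_loc_of_deriv_le
    (μ := MeasureTheory.volume) (a := 0) (b := 2 * π) (s := Set.univ)
    (F := fun (x t : ℝ) => Real.cos (n * t - x * Real.sin t))
    (F' := fun (x t : ℝ) => Real.sin t * Real.sin (n * t - x * Real.sin t))
    (x₀ := x) (bound := fun _ => 1) Filter.univ_mem
    (Filter.Eventually.of_forall fun y => (bes_cont n y).aestronglyMeasurable)
    ((bes_cont n x).intervalIntegrable _ _)
    (Continuous.aestronglyMeasurable (by fun_prop))
    (Filter.Eventually.of_forall fun t _ y _ => by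
      rw [norm_mul]
      exact mul_le_one₀ (Real.abs_sin_le_one _) (norm_nonneg _) (Real.abs_sin_le_one _))
    (by simp)
    (Filter.Eventually.of_forall fun t _ y _ => by
      have h : HasDerivAt (fun y : ℝ => n * t - y * Real.sin t) (0 - 1 * Real.sin t) y :=
        (hasDerivAt_const _ _).sub ((hasDerivAt_id y).mul_const _)
      refine h.cos.congr_deriv ?_
      ring)).2
  have k2 := key.const_mul (1 / (2 * π))
  refine HasDerivAt.congr_deriv (f := besselJ n) k2 ?_
  symm
  unfold besselJ
  rw [← mul_sub, ← intervalIntegral.integral_sub ((bes_cont _ x).intervalIntegrable _ _)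
    ((bes_cont _ x).intervalIntegrable _ _), mul_div_assoc, ← intervalIntegral.integral_div]
  congr 1
  apply intervalIntegral.integral_congr
  intro t _
  simp only
  have e1 : ((n - 1 : ℤ) : ℝ) * t - x * Real.sin t = (n * t - x * Real.sin t) - t := by
    push_cast; ring
  have e2 : ((n + 1 : ℤ) : ℝ) * t - x * Real.sin t = (n * t - x * Real.sin t) + t := by
    push_cast; ring
  rw [e1, e2, Real.cos_sub (n * t - x * Real.sin t) t, Real.cos_add (n * t - x * Real.sin t) t]
  ring

lemma bes_rec (n : ℤ) (x : ℝ) :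
    2 * n * besselJ n x = x * (besselJ (n - 1) x + besselJ (n + 1) x) := by
  have h0 : ∫ t in (0:ℝ)..(2 * π),
      (n - x * Real.cos t) * Real.cos (n * t - x * Real.sin t) = 0 := by
    rw [intervalIntegral.integral_eq_sub_of_hasDerivAt
      (f := fun t => Real.sin (n * t - x * Real.sin t))]
    · simp only [Real.sin_two_pi, Real.sin_zero, mul_zero, sub_zero]
      have := Real.sin_int_mul_pi (2 * n)
      push_cast at this
      rw [← this]; congr 1; ring
    · intro t _
      have h : HasDerivAt (fun t : ℝ => n * t - x * Real.sin t) (n * 1 - x * Real.cos t) t :=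
        ((hasDerivAt_id t).const_mul _).sub ((Real.hasDerivAt_sin t).const_mul _)
      refine h.sin.congr_deriv ?_
      ring
    · exact Continuous.intervalIntegrable (by fun_prop) _ _
  have h1 : ∫ t in (0:ℝ)..(2 * π), (n - x * Real.cos t) * Real.cos (n * t - x * Real.sin t) =
      n * (∫ t in (0:ℝ)..(2 * π), Real.cos (n * t - x * Real.sin t)) -
      x / 2 * ((∫ t in (0:ℝ)..(2 * π), Real.cos ((n - 1 : ℤ) * t - x * Real.sin t)) +
        ∫ t in (0:ℝ)..(2 * π), Real.cos ((n + 1 : ℤ) * t - x * Real.sin t)) := by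
    rw [← intervalIntegral.integral_add ((bes_cont _ x).intervalIntegrable _ _)
      ((bes_cont _ x).intervalIntegrable _ _), ← intervalIntegral.integral_const_mul,
      ← intervalIntegral.integral_const_mul, ← intervalIntegral.integral_sub]
    · apply intervalIntegral.integral_congr
      intro t _
      simp only
      have e1 : ((n - 1 : ℤ) : ℝ) * t - x * Real.sin t = (n * t - x * Real.sin t) - t := by
        push_cast; ring
      have e2 : ((n + 1 : ℤ) : ℝ) * t - x * Real.sin t = (n * t - x * Real.sin t) + t := by
        push_cast; ring
      rw [e1, e2, Real.cos_sub (n * t - x * Real.sin t) t, Real.cos_add (n * t - x * Real.sin t) t]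
      ring
    · exact Continuous.intervalIntegrable (by fun_prop) _ _
    · exact Continuous.intervalIntegrable (by fun_prop) _ _
  rw [h0] at h1
  unfold besselJ
  linear_combination (-2) * (1 / (2 * π)) * h1

lemma bes_d1 (n : ℤ) (x : ℝ) : x * besselJd n x = n * besselJ n x - x * besselJ (n + 1) x := by
  have := bes_rec n x
  rw [besselJd, (bes_hasDerivAt n x).deriv]
  linarith

lemma bes_d2 (n : ℤ) (x : ℝ) : x * besselJd n x = x * besselJ (n - 1) x - n * besselJ n x := by
  have := bes_rec n x
  rw [besselJd, (bes_hasDerivAt n x).deriv]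
  linarith

lemma bes_hd (n : ℤ) (x : ℝ) : HasDerivAt (besselJ n) (besselJd n x) x :=
  (bes_hasDerivAt n x).differentiableAt.hasDerivAt

lemma bes_zero_bounds (x : ℝ) : 1 - x ^ 2 / 2 ≤ besselJ 0 x ∧ besselJ 0 x ≤ 1 := by
  have hp := Real.pi_pos
  have i1 : IntervalIntegrable (fun t : ℝ => Real.cos (((0:ℤ):ℝ) * t - x * Real.sin t))
    MeasureTheory.volume 0 (2 * π) := (bes_cont 0 x).intervalIntegrable _ _
  have h1 : ∫ t in (0:ℝ)..(2 * π), Real.cos (((0:ℤ):ℝ) * t - x * Real.sin t) ≤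
      ∫ t in (0:ℝ)..(2 * π), (1:ℝ) :=
    intervalIntegral.integral_mono_on (by positivity) i1 (by simp)
      (fun t _ => Real.cos_le_one _)
  have h2 : ∫ t in (0:ℝ)..(2 * π), (1 - x ^ 2 / 2 : ℝ) ≤
      ∫ t in (0:ℝ)..(2 * π), Real.cos (((0:ℤ):ℝ) * t - x * Real.sin t) := by
    refine intervalIntegral.integral_mono_on (by positivity) (by simp) i1 (fun t _ => ?_)
    refine le_trans ?_ (Real.one_sub_sq_div_two_le_cos)
    have := Real.sin_sq_le_one t
    push_cast
    nlinarith [sq_nonneg x]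
  simp only [intervalIntegral.integral_const, smul_eq_mul, sub_zero] at h1 h2
  unfold besselJ
  constructor
  · rw [one_div, inv_mul_eq_div, le_div_iff₀ (by positivity)]; linarith
  · rw [one_div, inv_mul_eq_div, div_le_iff₀ (by positivity)]; linarith

/-- Leading coefficient. -/
noncomputable def besC (n : ℕ) : ℝ := 1 / (2 ^ n * (n.factorial : ℝ))

lemma besC_pos (n : ℕ) : 0 < besC n := by unfold besC; positivity

lemma besC_succ (n : ℕ) : 2 * (n + 1) * besC (n + 1) = besC n := by
  unfold besC
  rw [Nat.factorial_succ]
  push_cast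
  field_simp
  ring

lemma bes_pow_hd (n : ℕ) (x : ℝ) :
    HasDerivAt (fun x => x ^ (n + 1) * besselJ ((n + 1 : ℕ) : ℤ) x)
      (x ^ (n + 1) * besselJ (n : ℤ) x) x := by
  have h := (hasDerivAt_pow (n + 1) x).mul (bes_hd ((n + 1 : ℕ) : ℤ) x)
  refine HasDerivAt.congr_deriv h ?_
  have h2 := bes_d2 ((n + 1 : ℕ) : ℤ) x
  have e : (((n + 1 : ℕ) : ℤ) - 1) = (n : ℤ) := by push_cast; ring
  rw [e] at h2
  push_cast at h2 ⊢
  linear_combination (x ^ n) * h2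

lemma bes_bounds (n : ℕ) : ∀ x : ℝ, 0 < x → 
    besC n * x ^ n * (1 - x ^ 2 / 2) ≤ besselJ (n : ℤ) x ∧ besselJ (n : ℤ) x ≤ besC n * x ^ n := by
  induction n with
  | zero =>
    intro x _
    have := bes_zero_bounds x
    simpa [besC] using this
  | succ n ih =>
    intro x hx
    have hc := besC_succ n
    have hc0 := besC_pos (n + 1)
    have up : MonotoneOn (fun x : ℝ => besC (n + 1) * x ^ (2 * n + 2) -
        x ^ (n + 1) * besselJ ((n + 1 : ℕ) : ℤ) x) (Set.Ici 0) := by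
      have hd : ∀ y : ℝ, HasDerivAt (fun x : ℝ => besC (n + 1) * x ^ (2 * n + 2) -
        x ^ (n + 1) * besselJ ((n + 1 : ℕ) : ℤ) x) (besC (n + 1) * ((2 * n + 2 : ℕ) * y ^ (2 * n + 1)) -
        y ^ (n + 1) * besselJ (n : ℤ) y) y := fun y =>
        ((hasDerivAt_pow (2 * n + 2) y).const_mul _).sub (bes_pow_hd n y)
      refine monotoneOn_of_deriv_nonneg (convex_Ici 0)
        (fun y _ => (hd y).continuousAt.continuousWithinAt)
        (fun y _ => (hd y).differentiableAt.differentiableWithinAt) ?_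
      intro y hy
      rw [interior_Ici] at hy
      rw [(hd y).deriv]
      have h := mul_le_mul_of_nonneg_left (ih y hy).2 (pow_pos hy (n + 1)).le
      push_cast
      have e : besC (n + 1) * ((2 * n + 2) * y ^ (2 * n + 1)) = y ^ (n + 1) * (besC n * y ^ n) := by
        rw [← hc]; ring
      linarith
    have lo : MonotoneOn (fun x : ℝ => x ^ (n + 1) * besselJ ((n + 1 : ℕ) : ℤ) x -
        (besC (n + 1) * x ^ (2 * n + 2) - besC (n + 1) / 2 * x ^ (2 * n + 4))) (Set.Ici 0) := by
      have hd : ∀ y : ℝ, HasDerivAt (fun x : ℝ => x ^ (n + 1) * besselJ ((n + 1 : ℕ) : ℤ) x -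
        (besC (n + 1) * x ^ (2 * n + 2) - besC (n + 1) / 2 * x ^ (2 * n + 4)))
        (y ^ (n + 1) * besselJ (n : ℤ) y - (besC (n + 1) * ((2 * n + 2 : ℕ) * y ^ (2 * n + 1))
          - besC (n + 1) / 2 * ((2 * n + 4 : ℕ) * y ^ (2 * n + 3)))) y := fun y =>
        (bes_pow_hd n y).sub (((hasDerivAt_pow (2 * n + 2) y).const_mul _).sub
          ((hasDerivAt_pow (2 * n + 4) y).const_mul _))
      refine monotoneOn_of_deriv_nonneg (convex_Ici 0)
        (fun y _ => (hd y).continuousAt.continuousWithinAt)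
        (fun y _ => (hd y).differentiableAt.differentiableWithinAt) ?_
      intro y hy
      rw [interior_Ici] at hy
      rw [(hd y).deriv]
      have h := mul_le_mul_of_nonneg_left (ih y hy).1 (pow_pos hy (n + 1)).le
      push_cast
      have e : y ^ (n + 1) * (besC n * y ^ n * (1 - y ^ 2 / 2)) -
        (besC (n + 1) * ((2 * n + 2) * y ^ (2 * n + 1))
          - besC (n + 1) / 2 * ((2 * n + 4) * y ^ (2 * n + 3))) =
          besC (n + 1) * y ^ (2 * n + 3) := by
        rw [← hc]; ring
      have : 0 ≤ besC (n + 1) * y ^ (2 * n + 3) := mul_nonneg hc0.le (pow_pos hy _).le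
      linarith
    have hu := up (Set.mem_Ici.2 le_rfl) (Set.mem_Ici.2 hx.le) hx.le
    have hl := lo (Set.mem_Ici.2 le_rfl) (Set.mem_Ici.2 hx.le) hx.le
    simp at hu hl
    have hp := pow_pos hx (n + 1)
    constructor
    · refine le_of_mul_le_mul_left ?_ hp
      push_cast
      refine le_trans (le_of_eq ?_) (sub_le_iff_le_add.2 hl)
      ring
    · refine le_of_mul_le_mul_left ?_ hp
      push_cast
      refine le_trans hu (le_of_eq ?_)
      ring
/-- `u`. -/
noncomputable def uu (m : ℕ) (e : ℝ) : ℝ := besselJ m (m * e)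

/-- `w`. -/
noncomputable def ww (m : ℕ) (e : ℝ) : ℝ := e * besselJd m (m * e)

/-- `q`. -/
noncomputable def qq (m : ℕ) (e : ℝ) : ℝ := besselJ ((m + 1 : ℕ) : ℤ) (m * e) / (e * uu m e)

lemma comp_mul_hd (n : ℤ) (m e : ℝ) :
    HasDerivAt (fun e => besselJ n (m * e)) (m * besselJd n (m * e)) e := by
  have h : HasDerivAt (fun e : ℝ => m * e) (m * 1) e := (hasDerivAt_id e).const_mul m
  have := (bes_hd n (m * e)).comp e h
  refine HasDerivAt.congr_deriv this ?_
  ring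

lemma uu_hd (m : ℕ) {e : ℝ} (he : e ≠ 0) : HasDerivAt (uu m) (m * ww m e / e) e := by
  refine HasDerivAt.congr_deriv (f := uu m) (comp_mul_hd m m e) ?_
  unfold ww
  field_simp

lemma ww_eq (m : ℕ) (hm : m ≠ 0) (e : ℝ) :
    ww m e = uu m e - e * besselJ ((m + 1 : ℕ) : ℤ) (m * e) := by
  have h := bes_d1 m (m * e)
  have hm' : (m : ℝ) ≠ 0 := by exact_mod_cast hm
  unfold ww uu
  push_cast at h ⊢
  refine mul_left_cancel₀ hm' ?_
  linear_combination h

lemma ww_hd (m : ℕ) (hm : m ≠ 0) {e : ℝ} (he : e ≠ 0) :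
    HasDerivAt (ww m) (m * (1 - e ^ 2) * uu m e / e) e := by
  have e0 : ww m = fun e => uu m e - e * besselJ ((m + 1 : ℕ) : ℤ) (m * e) :=
    funext (ww_eq m hm)
  have h1 := (uu_hd m he).sub ((hasDerivAt_id e).mul (comp_mul_hd ((m + 1 : ℕ) : ℤ) m e))
  rw [e0]
  refine HasDerivAt.congr_deriv h1 ?_
  have h2 := bes_d2 ((m + 1 : ℕ) : ℤ) (m * e)
  have h3 := ww_eq m hm e
  have e1 : (((m + 1 : ℕ) : ℤ) - 1) = (m : ℤ) := by push_cast; ring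
  rw [e1] at h2
  change (m : ℝ) * e * besselJd ((m + 1 : ℕ) : ℤ) (m * e) = m * e * uu m e - _ at h2
  simp only [id]
  field_simp
  push_cast at *
  linear_combination (-e) * h2 + m * h3

lemma uu_bounds (m : ℕ) (hm : m ≠ 0) {e : ℝ} (he : 0 < e) :
    besC m * (m * e) ^ m * (1 - (m * e) ^ 2 / 2) ≤ uu m e ∧ uu m e ≤ besC m * (m * e) ^ m := by
  have hm' : (0 : ℝ) < m := by exact_mod_cast Nat.pos_of_ne_zero hm
  exact bes_bounds m (m * e) (by positivity)

lemma small_ev (m : ℕ) : ∀ᶠ e : ℝ in nhdsWithin 0 (Ioi 0), 0 < e ∧ e < 1 ∧ 0 < 1 - (m * e) ^ 2 / 2 := by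
  have h1 : ∀ᶠ e : ℝ in nhdsWithin 0 (Ioi 0), 0 < e := self_mem_nhdsWithin
  have h2 : ∀ᶠ e : ℝ in nhdsWithin 0 (Ioi 0), e < 1 :=
    nhdsWithin_le_nhds (Iio_mem_nhds one_pos)
  have h3 : ∀ᶠ e : ℝ in nhdsWithin 0 (Ioi 0), 0 < 1 - (m * e) ^ 2 / 2 := by
    apply nhdsWithin_le_nhds
    have : ContinuousAt (fun e : ℝ => 1 - (m * e) ^ 2 / 2) 0 := by fun_prop
    exact this.eventually (lt_mem_nhds (by norm_num))
  filter_upwards [h1, h2, h3] with e a b c using ⟨a, b, c⟩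

lemma uu_pos_ev (m : ℕ) (hm : m ≠ 0) :
    ∀ᶠ e : ℝ in nhdsWithin 0 (Ioi 0), 0 < uu m e := by
  have hm' : (0 : ℝ) < m := by exact_mod_cast Nat.pos_of_ne_zero hm
  filter_upwards [small_ev m] with e he
  obtain ⟨h1, h2, h3⟩ := he
  have := besC_pos m
  exact lt_of_lt_of_le (by positivity) (uu_bounds m hm h1).1

lemma qq_tendsto (m : ℕ) (hm : m ≠ 0) :
    Filter.Tendsto (qq m) (nhdsWithin 0 (Ioi 0)) (nhds (m / (2 * (m + 1)))) := by
  have hm' : (0 : ℝ) < m := by exact_mod_cast Nat.pos_of_ne_zero hm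
  set L : ℝ := m / (2 * (m + 1)) with hL
  have hL0 : 0 < L := by positivity
  have hcL : m * besC (m + 1) = L * besC m := by
    rw [← besC_succ m, hL]; field_simp
  have t1 : Filter.Tendsto (fun e : ℝ => L * (1 - (m * e) ^ 2 / 2)) (nhdsWithin 0 (Ioi 0)) (nhds L) := by
    have : ContinuousAt (fun e : ℝ => L * (1 - (m * e) ^ 2 / 2)) 0 := by fun_prop
    have := this.tendsto
    simp at this
    exact this.mono_left nhdsWithin_le_nhds
  have t2 : Filter.Tendsto (fun e : ℝ => L / (1 - (m * e) ^ 2 / 2)) (nhdsWithin 0 (Ioi 0)) (nhds L) := by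
    have : ContinuousAt (fun e : ℝ => L / (1 - (m * e) ^ 2 / 2)) 0 := by
      apply ContinuousAt.div (by fun_prop) (by fun_prop); norm_num
    have := this.tendsto
    simp at this
    exact this.mono_left nhdsWithin_le_nhds
  refine tendsto_of_tendsto_of_tendsto_of_le_of_le' t1 t2 ?_ ?_
  · filter_upwards [small_ev m, uu_pos_ev m hm] with e he hu
    obtain ⟨h1, h2, h3⟩ := he
    have hx : 0 < (m : ℝ) * e := by positivity
    have b1 := (bes_bounds (m + 1) (m * e) hx).1
    have b2 := (uu_bounds m hm h1).2
    unfold qq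
    rw [le_div_iff₀ (by positivity)]
    refine le_trans ?_ b1
    calc L * (1 - (m * e) ^ 2 / 2) * (e * uu m e)
        ≤ L * (1 - (m * e) ^ 2 / 2) * (e * (besC m * (m * e) ^ m)) := by gcongr
      _ = _ := by
        rw [pow_succ]
        linear_combination (-(1 - (m * e) ^ 2 / 2) * e * (m * e) ^ m) * hcL
  · filter_upwards [small_ev m, uu_pos_ev m hm] with e he hu
    obtain ⟨h1, h2, h3⟩ := he
    have hx : 0 < (m : ℝ) * e := by positivity
    have b1 := (bes_bounds (m + 1) (m * e) hx).2
    have b2 := (uu_bounds m hm h1).1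
    unfold qq
    rw [div_le_div_iff₀ (by positivity) h3]
    calc besselJ ((m + 1 : ℕ) : ℤ) (m * e) * (1 - (m * e) ^ 2 / 2)
        ≤ (besC (m + 1) * (m * e) ^ (m + 1)) * (1 - (m * e) ^ 2 / 2) := by gcongr
      _ = L * (e * (besC m * (m * e) ^ m * (1 - (m * e) ^ 2 / 2))) := by
        rw [pow_succ]
        linear_combination ((1 - (m * e) ^ 2 / 2) * e * (m * e) ^ m) * hcL
      _ ≤ _ := by gcongr

lemma ww_q (m : ℕ) (hm : m ≠ 0) {e : ℝ} (he : e ≠ 0) (hu : uu m e ≠ 0) :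
    ww m e = uu m e * (1 - e ^ 2 * qq m e) := by
  rw [ww_eq m hm, qq]
  field_simp

lemma ww_pos_ev (m : ℕ) (hm : m ≠ 0) :
    ∀ᶠ e : ℝ in nhdsWithin 0 (Ioi 0), 0 < ww m e := by
  have t0 : Filter.Tendsto (fun e : ℝ => e) (nhdsWithin 0 (Ioi 0)) (nhds 0) :=
    Filter.tendsto_id.mono_left nhdsWithin_le_nhds
  have t := ((t0.pow 2).mul (qq_tendsto m hm)).const_sub 1
  have h := t.eventually (lt_mem_nhds (a := 0) (by norm_num))
  filter_upwards [h, uu_pos_ev m hm, small_ev m] with e h1 h2 h3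
  rw [ww_q m hm h3.1.ne' h2.ne']
  exact mul_pos h2 h1

lemma uw_pos (m : ℕ) (hm : m ≠ 0) {e : ℝ} (he : 0 < e) (he1 : e ≤ 1) : 0 < uu m e ∧ 0 < ww m e := by
  obtain ⟨e0, ⟨hu, hw⟩, h0, hlt⟩ := (((uu_pos_ev m hm).and (ww_pos_ev m hm)).and
    ((small_ev m).and
      (nhdsWithin_le_nhds (Iio_mem_nhds he) : ∀ᶠ y in nhdsWithin 0 (Ioi 0), y < e))).exists
  replace h0 : 0 < e0 := h0.1
  have hd : ∀ y ∈ Icc e0 e, HasDerivAt (fun y => uu m y * ww m y)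
      (m * ww m y / y * ww m y + uu m y * (m * (1 - y ^ 2) * uu m y / y)) y := by
    intro y hy
    have hy0 : y ≠ 0 := (lt_of_lt_of_le h0 hy.1).ne'
    exact (uu_hd m hy0).mul (ww_hd m hm hy0)
  have mono : MonotoneOn (fun y => uu m y * ww m y) (Icc e0 e) := by
    refine monotoneOn_of_deriv_nonneg (convex_Icc _ _)
        (fun y hy => (hd y hy).continuousAt.continuousWithinAt)
        (fun y hy => (hd y (interior_subset hy)).differentiableAt.differentiableWithinAt) ?_
    intro y hy
    have hy' := interior_subset hy
    rw [(hd y hy').deriv]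
    have hy0 : 0 < y := lt_of_lt_of_le h0 hy'.1
    have hy1 : 0 ≤ 1 - y ^ 2 := by nlinarith [hy'.2]
    have e1 : m * ww m y / y * ww m y + uu m y * (m * (1 - y ^ 2) * uu m y / y) =
      m / y * (ww m y ^ 2 + (1 - y ^ 2) * uu m y ^ 2) := by ring
    rw [e1]; positivity
  have hprod : ∀ y ∈ Icc e0 e, 0 < uu m y * ww m y := fun y hy =>
    lt_of_lt_of_le (mul_pos hu hw) (mono (left_mem_Icc.2 hlt.le) hy hy.1)
  have hupos : 0 < uu m e := by
    by_contra hneg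
    push Not at hneg
    have hc : ContinuousOn (uu m) (Icc e0 e) := fun y hy =>
      (uu_hd m (lt_of_lt_of_le h0 hy.1).ne').continuousAt.continuousWithinAt
    obtain ⟨y, hy, hy0⟩ := intermediate_value_Icc' hlt.le hc ⟨hneg, hu.le⟩
    have := hprod y hy
    rw [hy0] at this
    simp at this
  exact ⟨hupos, pos_of_mul_pos_right (hprod e (right_mem_Icc.2 hlt.le)) hupos.le⟩

/-- numerator of `A'`. -/
noncomputable def aa (m : ℕ) (e : ℝ) : ℝ :=
  (4 + 2 * m ^ 2 * (1 - e ^ 2) ^ 2) * uu m e - m * (5 + (1 - e ^ 2)) * ww m e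

/-- numerator of `B'`. -/
noncomputable def bb (m : ℕ) (e : ℝ) : ℝ :=
  (1 + (1 - e ^ 2) + m ^ 2 * (1 - e ^ 2) ^ 2) * ww m e - 3 * m * (1 - e ^ 2) * uu m e

lemma y_hd (e : ℝ) : HasDerivAt (fun e : ℝ => 1 - e ^ 2) (-(2 * e)) e := by
  refine HasDerivAt.congr_deriv ((hasDerivAt_pow 2 e).const_sub 1) ?_
  simp

lemma coefA_eq (m : ℕ) (e : ℝ) : coefA m e =
    (4 / ((m:ℝ) ^ 2 * e ^ 2)) *
      (2 * m * (1 - e ^ 2) * ww m e - (1 + (1 - e ^ 2)) * uu m e) := by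
  unfold coefA ww uu; ring

lemma coefB_eq (m : ℕ) (e : ℝ) : coefB m e =
    (4 / ((m:ℝ) ^ 2 * e ^ 2)) * (-2 * Real.sqrt (1 - e ^ 2) *
      (ww m e - m * (1 - e ^ 2) * uu m e)) := by
  unfold coefB ww uu; ring

lemma pref_hd (m : ℕ) (hm : m ≠ 0) {e : ℝ} (he : e ≠ 0) :
    HasDerivAt (fun e : ℝ => 4 / ((m:ℝ) ^ 2 * e ^ 2)) (-(8 / ((m:ℝ) ^ 2 * e ^ 3))) e := by
  have hm' : (m : ℝ) ≠ 0 := by exact_mod_cast hm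
  have h := (hasDerivAt_const e (4:ℝ)).div ((hasDerivAt_pow 2 e).const_mul ((m:ℝ) ^ 2))
    (by positivity)
  refine HasDerivAt.congr_deriv h ?_
  simp
  field_simp
  norm_num

lemma coefA_hd (m : ℕ) (hm : m ≠ 0) {e : ℝ} (he : e ≠ 0) :
    HasDerivAt (coefA m) (4 / ((m:ℝ) ^ 2 * e ^ 3) * aa m e) e := by
  have hm' : (m : ℝ) ≠ 0 := by exact_mod_cast hm
  rw [show coefA m = _ from funext (coefA_eq m)]
  have h := (pref_hd m hm he).mul ((((y_hd e).const_mul (2 * (m:ℝ))).mul (ww_hd m hm he)).sub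
    (((y_hd e).const_add 1).mul (uu_hd m he)))
  refine HasDerivAt.congr_deriv h ?_
  simp only [aa, Pi.mul_apply, Pi.sub_apply]
  field_simp
  ring

lemma eta_hd {e : ℝ} (he : 0 < 1 - e ^ 2) :
    HasDerivAt (fun e : ℝ => Real.sqrt (1 - e ^ 2)) (-e / Real.sqrt (1 - e ^ 2)) e := by
  refine HasDerivAt.congr_deriv ((y_hd e).sqrt he.ne') ?_
  have : Real.sqrt (1 - e ^ 2) ≠ 0 := (Real.sqrt_pos.2 he).ne'
  field_simp

lemma coefB_hd (m : ℕ) (hm : m ≠ 0) {e : ℝ} (he : e ≠ 0) (he1 : 0 < 1 - e ^ 2) :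
    HasDerivAt (coefB m) (8 / ((m:ℝ) ^ 2 * e ^ 3 * Real.sqrt (1 - e ^ 2)) * bb m e) e := by
  have hm' : (m : ℝ) ≠ 0 := by exact_mod_cast hm
  rw [show coefB m = _ from funext (coefB_eq m)]
  have h := (pref_hd m hm he).mul (((eta_hd he1).const_mul (-2)).mul ((ww_hd m hm he).sub
    (((y_hd e).const_mul (m:ℝ)).mul (uu_hd m he))))
  refine HasDerivAt.congr_deriv h ?_
  have hs0 : Real.sqrt (1 - e ^ 2) ≠ 0 := (Real.sqrt_pos.2 he1).ne'
  have hs : Real.sqrt (1 - e ^ 2) ^ 2 = 1 - e ^ 2 := Real.sq_sqrt he1.le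
  simp only [bb, Pi.mul_apply, Pi.sub_apply]
  generalize Real.sqrt (1 - e ^ 2) = s at *
  have he2 : e ^ 2 = 1 - s ^ 2 := by linarith
  field_simp
  simp only [hs]
  ring

lemma aa_hd (m : ℕ) (hm : m ≠ 0) {e : ℝ} (he : e ≠ 0) :
    HasDerivAt (aa m) ((uu m e * (m ^ 2 * (1 - e ^ 2) * (7 * (1 - e ^ 2) - 13)) +
      ww m e * (m * (6 - 2 * (1 - e ^ 2) + 2 * m ^ 2 * (1 - e ^ 2) ^ 2))) / e) e := by
  have h := (((((y_hd e).pow 2).const_mul (2 * (m:ℝ) ^ 2)).const_add 4).mul (uu_hd m he)).sub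
    ((((y_hd e).const_add 5).const_mul (m:ℝ)).mul (ww_hd m hm he))
  refine HasDerivAt.congr_deriv h ?_
  simp only [Pi.mul_apply, Pi.sub_apply, Pi.pow_apply]
  field_simp
  ring

lemma bb_diff (m : ℕ) (hm : m ≠ 0) {e : ℝ} (he : e ≠ 0) : DifferentiableAt ℝ (bb m) e := by
  have h1 := (uu_hd m he).differentiableAt
  have h2 := (ww_hd m hm he).differentiableAt
  unfold bb
  fun_prop

lemma e_facts {e : ℝ} (he : e ∈ Ioo (0:ℝ) 1) : e ≠ 0 ∧ 0 < 1 - e ^ 2 ∧ 1 - e ^ 2 < 1 := by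
  obtain ⟨h0, h1⟩ := he
  refine ⟨h0.ne', by nlinarith, by nlinarith [pow_pos h0 2]⟩

lemma A1_eq (m : ℕ) (hm : m ≠ 0) {e : ℝ} (he : e ∈ Ioo (0:ℝ) 1) :
    deriv (coefA m) e = 4 / ((m:ℝ) ^ 2 * e ^ 3) * aa m e :=
  (coefA_hd m hm (e_facts he).1).deriv

lemma B1_eq (m : ℕ) (hm : m ≠ 0) {e : ℝ} (he : e ∈ Ioo (0:ℝ) 1) :
    deriv (coefB m) e = 8 / ((m:ℝ) ^ 2 * e ^ 3 * Real.sqrt (1 - e ^ 2)) * bb m e :=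
  (coefB_hd m hm (e_facts he).1 (e_facts he).2.1).deriv

lemma A1_diff (m : ℕ) (hm : m ≠ 0) {e : ℝ} (he : e ∈ Ioo (0:ℝ) 1) :
    DifferentiableAt ℝ (deriv (coefA m)) e := by
  have hm' : (m : ℝ) ≠ 0 := by exact_mod_cast hm
  have hev : deriv (coefA m) =ᶠ[nhds e] fun e => 4 / ((m:ℝ) ^ 2 * e ^ 3) * aa m e := by
    filter_upwards [isOpen_Ioo.mem_nhds he] with x hx using A1_eq m hm hx
  refine DifferentiableAt.congr_of_eventuallyEq ?_ hev
  have h1 := (aa_hd m hm (e_facts he).1).differentiableAt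
  have h2 : (m:ℝ) ^ 2 * e ^ 3 ≠ 0 := mul_ne_zero (pow_ne_zero _ hm') (pow_ne_zero _ (e_facts he).1)
  fun_prop (disch := exact h2)

lemma B1_diff (m : ℕ) (hm : m ≠ 0) {e : ℝ} (he : e ∈ Ioo (0:ℝ) 1) :
    DifferentiableAt ℝ (deriv (coefB m)) e := by
  have hm' : (m : ℝ) ≠ 0 := by exact_mod_cast hm
  have hev : deriv (coefB m) =ᶠ[nhds e]
      fun e => 8 / ((m:ℝ) ^ 2 * e ^ 3 * Real.sqrt (1 - e ^ 2)) * bb m e := by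
    filter_upwards [isOpen_Ioo.mem_nhds he] with x hx using B1_eq m hm hx
  refine DifferentiableAt.congr_of_eventuallyEq ?_ hev
  have h1 := bb_diff m hm (e_facts he).1
  have h3 := (eta_hd (e_facts he).2.1).differentiableAt
  have h2 : (m:ℝ) ^ 2 * e ^ 3 * Real.sqrt (1 - e ^ 2) ≠ 0 :=
    mul_ne_zero (mul_ne_zero (pow_ne_zero _ hm') (pow_ne_zero _ (e_facts he).1))
      (Real.sqrt_pos.2 (e_facts he).2.1).ne'
  refine DifferentiableAt.mul (DifferentiableAt.div (by fun_prop) (DifferentiableAt.mul (by fun_prop) h3) h2) h1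

lemma A2_eq (m : ℕ) (hm : m ≠ 0) {e : ℝ} (he : e ∈ Ioo (0:ℝ) 1) (ha : aa m e = 0) :
    deriv (deriv (coefA m)) e = 4 / ((m:ℝ) ^ 2 * e ^ 3) * deriv (aa m) e := by
  have hm' : (m : ℝ) ≠ 0 := by exact_mod_cast hm
  have hev : deriv (coefA m) =ᶠ[nhds e] fun e => 4 / ((m:ℝ) ^ 2 * e ^ 3) * aa m e := by
    filter_upwards [isOpen_Ioo.mem_nhds he] with x hx using A1_eq m hm hx
  rw [hev.deriv_eq]
  have h1 := (aa_hd m hm (e_facts he).1).differentiableAt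
  have h2 : (m:ℝ) ^ 2 * e ^ 3 ≠ 0 := mul_ne_zero (pow_ne_zero _ hm') (pow_ne_zero _ (e_facts he).1)
  have h3 : DifferentiableAt ℝ (fun e : ℝ => 4 / ((m:ℝ) ^ 2 * e ^ 3)) e := by
    fun_prop (disch := exact h2)
  have := (h3.hasDerivAt.mul h1.hasDerivAt).deriv
  rw [ha, mul_zero, zero_add] at this
  exact this

/-- Pure algebra. -/
lemma alg_D {m y u w : ℝ} (hu : 0 < u) (hw : 0 < w)
    (h1 : (4 + 2 * m ^ 2 * y ^ 2) * u - m * (5 + y) * w = 0)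
    (h2 : (1 + y + m ^ 2 * y ^ 2) * w - 3 * m * y * u = 0) :
    (4 + 2 * m ^ 2 * y ^ 2) * (1 + y + m ^ 2 * y ^ 2) - 3 * m ^ 2 * y * (5 + y) = 0 := by
  have : u * w ≠ 0 := (mul_pos hu hw).ne'
  refine (mul_eq_zero.1 (?_ : _ * (u * w) = 0)).resolve_right this
  linear_combination (1 + y + m ^ 2 * y ^ 2) * w * h1 + m * (5 + y) * w * h2

lemma alg_common2 {m y u w : ℝ} (hm : 2 ≤ m) (hy : 0 < y) (hy1 : y < 1) (hu : 0 < u) (hw : 0 < w)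
    (h1 : (4 + 2 * m ^ 2 * y ^ 2) * u - m * (5 + y) * w = 0)
    (h2 : (1 + y + m ^ 2 * y ^ 2) * w - 3 * m * y * u = 0)
    (h3 : u * (m ^ 2 * y * (7 * y - 13)) + w * (m * (6 - 2 * y + 2 * m ^ 2 * y ^ 2)) = 0) : False := by
  have hD := alg_D hu hw h1 h2
  have hm0 : m ≠ 0 := by linarith
  have hG : (4 + 2 * m ^ 2 * y ^ 2) * (6 - 2 * y + 2 * m ^ 2 * y ^ 2) +
      m ^ 2 * y * (7 * y - 13) * (5 + y) = 0 := by
    have : m * w ≠ 0 := mul_ne_zero hm0 hw.ne'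
    refine (mul_eq_zero.1 (?_ : _ * (m * w) = 0)).resolve_right this
    linear_combination (4 + 2 * m ^ 2 * y ^ 2) * h3 - m ^ 2 * y * (7 * y - 13) * h1
  have hz : m ^ 2 * y * (35 - y) = 16 := by
    have : y - 1 ≠ 0 := by linarith
    have h := (mul_eq_zero.1 (show (y - 1) * (m ^ 2 * y * (35 - y) - 16) = 0 by
      linear_combination hG - 2 * hD)).resolve_left this
    linarith
  obtain ⟨z, hzd⟩ : ∃ z, z = m ^ 2 * y := ⟨_, rfl⟩
  rw [← hzd] at hz
  have hM : 4 ≤ m ^ 2 := by nlinarith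
  have hyz : 4 * y ≤ z := by rw [hzd]; nlinarith
  have hz1 : z ≤ 1 / 2 := by nlinarith
  have hz2 : 16 ≤ 35 * z := by nlinarith
  have hD' : 2 * z ^ 2 * y ^ 2 + 2 * z * y ^ 2 + 3 * z * y - 15 * z + 4 + 4 * y = 0 := by
    rw [hzd]; linear_combination hD
  have hy8 : y ≤ 1 / 8 := by linarith
  have a1 : z * y ≤ 1 / 16 := by nlinarith
  have a2 : z * y ^ 2 ≤ 1 / 16 := by nlinarith
  have a3 : z ^ 2 * y ^ 2 ≤ 1 / 16 := by nlinarith [mul_pos (show 0 < z by linarith) hy]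
  nlinarith

lemma alg_common1 {m y u w s d : ℝ} (hy : 0 < y) (hy1 : y < 1)
    (hu : 0 < u) (hw : 0 < w)
    (h1 : (4 + 2 * m ^ 2 * y ^ 2) * u - m * (5 + y) * w = 0)
    (h2 : (1 + y + m ^ 2 * y ^ 2) * w - 3 * m * y * u = 0)
    (hs : s ^ 2 = y) (hd : d ^ 2 = 1)
    (h : 2 * m * y * w - (1 + y) * u = d * (2 * s * (w - m * y * u))) : False := by
  have hD := alg_D hu hw h1 h2
  obtain ⟨X, hX⟩ : ∃ X, X = m ^ 2 * y ^ 2 := ⟨_, rfl⟩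
  have hD2 : 2 * y * X ^ 2 + (2 * y ^ 2 + 3 * y - 15) * X + 4 * y * (1 + y) = 0 := by
    rw [hX]; linear_combination y * hD
  have hsq : (2 * m * y * w - (1 + y) * u) ^ 2 = 4 * y * (w - m * y * u) ^ 2 := by
    rw [h]; linear_combination 4 * (w - m * y * u) ^ 2 * (s ^ 2 * hd + hs)
  have k1 : (1 + y + m ^ 2 * y ^ 2) * (2 * m * y * w - (1 + y) * u) =
      u * ((5 - y) * X - (1 + y) ^ 2) := by
    rw [hX]; linear_combination 2 * m * y * h2
  have k2 : (1 + y + m ^ 2 * y ^ 2) * (w - m * y * u) = u * (m * y * (2 - y - X)) := by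
    rw [hX]; linear_combination h2
  have hE : ((5 - y) * X - (1 + y) ^ 2) ^ 2 - 4 * y * X * (2 - y - X) ^ 2 = 0 := by
    have : u ^ 2 ≠ 0 := by positivity
    refine (mul_eq_zero.1 (?_ : u ^ 2 * _ = 0)).resolve_left this
    calc u ^ 2 * (((5 - y) * X - (1 + y) ^ 2) ^ 2 - 4 * y * X * (2 - y - X) ^ 2) 
        = (u * ((5 - y) * X - (1 + y) ^ 2)) ^ 2 - 4 * y * (u * (m * y * (2 - y - X))) ^ 2 := by
          rw [hX]; ring
      _ = 0 := by
        rw [← k1, ← k2]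
        linear_combination (1 + y + m ^ 2 * y ^ 2) ^ 2 * hsq
  have hXq : X * (75 - 25 * y - 2 * y ^ 2) = 2 * y * (1 + y) * (y + 11) := by
    have : (y - 1) ^ 2 ≠ 0 := pow_ne_zero _ (by linarith)
    have h := (mul_eq_zero.1 (show (y - 1) ^ 2 * (X * (75 - 25 * y - 2 * y ^ 2) -
      2 * y * (1 + y) * (y + 11)) = 0 by
      linear_combination (-1) * (2 * y * (hE + 2 * X * hD2) - (-5 + 12 * y - 3 * y ^ 2) * hD2))).resolve_left this
    linarith
  have hfin : 4 * y * (1 + y) * ((y - 1) * (1125 + 3150 * y + 261 * y ^ 2)) = 0 := by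
    have h1 : 2 * y * (X * (75 - 25 * y - 2 * y ^ 2)) ^ 2 +
      (2 * y ^ 2 + 3 * y - 15) * (X * (75 - 25 * y - 2 * y ^ 2)) * (75 - 25 * y - 2 * y ^ 2)
      + 4 * y * (1 + y) * (75 - 25 * y - 2 * y ^ 2) ^ 2 = 0 := by
      linear_combination (75 - 25 * y - 2 * y ^ 2) ^ 2 * hD2
    rw [hXq] at h1
    linear_combination 2 * h1
  have p1 : 0 < 4 * y * (1 + y) := by positivity
  have p2 : 0 < 1125 + 3150 * y + 261 * y ^ 2 := by positivity
  rcases mul_eq_zero.1 hfin with h | h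
  · linarith
  · rcases mul_eq_zero.1 h with h | h <;> linarith

/-- Combined numerator. -/
noncomputable def Phi (m : ℕ) (c e : ℝ) : ℝ :=
  (1 + c) * Real.sqrt (1 - e ^ 2) * aa m e + 2 * (1 - c) * bb m e

lemma h_eq (m : ℕ) (hm : m ≠ 0) (c : ℝ) {e : ℝ} (he : e ∈ Ioo (0:ℝ) 1) :
    (deriv (coefA m) e + deriv (coefB m) e) + c * (deriv (coefA m) e - deriv (coefB m) e) =
      4 / ((m:ℝ) ^ 2 * e ^ 3 * Real.sqrt (1 - e ^ 2)) * Phi m c e := by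
  have hm' : (m : ℝ) ≠ 0 := by exact_mod_cast hm
  have hs : Real.sqrt (1 - e ^ 2) ≠ 0 := (Real.sqrt_pos.2 (e_facts he).2.1).ne'
  have h0 := (e_facts he).1
  rw [A1_eq m hm he, B1_eq m hm he, Phi]
  field_simp
  ring

lemma h_pref_pos (m : ℕ) (hm : m ≠ 0) {e : ℝ} (he : e ∈ Ioo (0:ℝ) 1) :
    0 < 4 / ((m:ℝ) ^ 2 * e ^ 3 * Real.sqrt (1 - e ^ 2)) := by
  have hm' : (0 : ℝ) < m := by exact_mod_cast Nat.pos_of_ne_zero hm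
  have hs : 0 < Real.sqrt (1 - e ^ 2) := (Real.sqrt_pos.2 (e_facts he).2.1)
  have h0 := he.1
  positivity

lemma Phi_cont (m : ℕ) (hm : m ≠ 0) (c : ℝ) {e : ℝ} (he : e ≠ 0) : ContinuousAt (Phi m c) e := by
  have h1 := (aa_hd m hm he).continuousAt
  have h2 := (bb_diff m hm he).continuousAt
  unfold Phi
  fun_prop

lemma pair_tendsto (m : ℕ) (hm : m ≠ 0) :
    Filter.Tendsto (fun e : ℝ => (e, qq m e)) (nhdsWithin 0 (Ioi 0))
      (nhds ((0:ℝ), (m / (2 * (m + 1)) : ℝ))) :=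
  (Filter.tendsto_id.mono_left nhdsWithin_le_nhds).prodMk_nhds (qq_tendsto m hm)

lemma Phi_pos_ev (m : ℕ) (hm : 3 ≤ m) (c : ℝ) :
    ∀ᶠ e : ℝ in nhdsWithin 0 (Ioi 0), 0 < Phi m c e := by
  have hm0 : m ≠ 0 := by omega
  have hm3 : (3 : ℝ) ≤ m := by exact_mod_cast hm
  let g : ℝ × ℝ → ℝ := fun p =>
    (1 + c) * Real.sqrt (1 - p.1 ^ 2) * ((4 + 2 * m ^ 2 * (1 - p.1 ^ 2) ^ 2) -
      m * (5 + (1 - p.1 ^ 2)) * (1 - p.1 ^ 2 * p.2)) +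
    2 * (1 - c) * ((1 + (1 - p.1 ^ 2) + m ^ 2 * (1 - p.1 ^ 2) ^ 2) * (1 - p.1 ^ 2 * p.2)
      - 3 * m * (1 - p.1 ^ 2))
  have hg : Continuous g := by fun_prop
  have t := (hg.tendsto _).comp (pair_tendsto m hm0)
  have hpos : 0 < g ((0:ℝ), (m / (2 * (m + 1)) : ℝ)) := by
    have : g ((0:ℝ), (m / (2 * (m + 1)) : ℝ)) = 4 * ((m - 1) * (m - 2)) := by
      simp [g]; ring
    rw [this]
    have := mul_pos (show (0:ℝ) < m - 1 by linarith) (show (0:ℝ) < m - 2 by linarith)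
    linarith
  filter_upwards [t.eventually (lt_mem_nhds hpos), uu_pos_ev m hm0, small_ev m] with e h1 h2 h3
  have : Phi m c e = uu m e * g (e, qq m e) := by
    simp only [Phi, aa, bb, g]
    rw [ww_q m hm0 h3.1.ne' h2.ne']
    ring
  rw [this]
  exact mul_pos h2 h1

lemma Phi_neg_ev (c : ℝ) :
    ∀ᶠ e : ℝ in nhdsWithin 0 (Ioi 0), Phi 2 c e < 0 := by
  have hm0 : (2:ℕ) ≠ 0 := by omega
  let g : ℝ × ℝ → ℝ := fun p =>
    (1 + c) * Real.sqrt (1 - p.1 ^ 2) * (-14 + 8 * p.1 ^ 2 + 12 * p.2 - 2 * p.2 * p.1 ^ 2) +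
    2 * (1 - c) * (-3 + 4 * p.1 ^ 2 - p.2 * (6 - 9 * p.1 ^ 2 + 4 * p.1 ^ 4))
  have hg : Continuous g := by fun_prop
  have t := (hg.tendsto _).comp (pair_tendsto 2 hm0)
  have hneg : g ((0:ℝ), (((2:ℕ):ℝ) / (2 * (((2:ℕ):ℝ) + 1)) : ℝ)) < 0 := by
    have : g ((0:ℝ), (((2:ℕ):ℝ) / (2 * (((2:ℕ):ℝ) + 1)) : ℝ)) = -20 := by
      simp [g]; ring
    rw [this]; norm_num
  filter_upwards [t.eventually (gt_mem_nhds hneg), uu_pos_ev 2 hm0, small_ev 2] with e h1 h2 h3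
  have : Phi 2 c e = (uu 2 e * e ^ 2) * g (e, qq 2 e) := by
    simp only [Phi, aa, bb, g]
    rw [ww_q 2 hm0 h3.1.ne' h2.ne']
    push_cast
    ring
  rw [this]
  exact mul_neg_of_pos_of_neg (mul_pos h2 (pow_pos h3.1 2)) h1

lemma P_pos_ev (m : ℕ) (hm : 2 ≤ m) :
    ∀ᶠ e : ℝ in nhdsWithin 0 (Ioi 0), 0 < coefA m e + coefB m e := by
  have hm0 : m ≠ 0 := by omega
  have hm3 : (2 : ℝ) ≤ m := by exact_mod_cast hm
  let g : ℝ × ℝ → ℝ := fun p =>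
    (2 * m * (1 - p.1 ^ 2) * (1 - p.1 ^ 2 * p.2) - (1 + (1 - p.1 ^ 2))) +
     (-2 * Real.sqrt (1 - p.1 ^ 2) * ((1 - p.1 ^ 2 * p.2) - m * (1 - p.1 ^ 2)))
  have hg : Continuous g := by fun_prop
  have t := (hg.tendsto _).comp (pair_tendsto m hm0)
  have hpos : 0 < g ((0:ℝ), (m / (2 * (m + 1)) : ℝ)) := by
    have : g ((0:ℝ), (m / (2 * (m + 1)) : ℝ)) = 4 * (m - 1) := by
      simp [g]; ring
    rw [this]
    linarith
  filter_upwards [t.eventually (lt_mem_nhds hpos), uu_pos_ev m hm0, small_ev m] with e h1 h2 h3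
  have : coefA m e + coefB m e = (4 / ((m:ℝ) ^ 2 * e ^ 2)) * uu m e * g (e, qq m e) := by
    rw [coefA_eq, coefB_eq]
    simp only [g]
    rw [ww_q m hm0 h3.1.ne' h2.ne']
    ring
  rw [this]
  have := h3.1
  have h1' : 0 < g (e, qq m e) := h1
  positivity

lemma P_neg_exists (m : ℕ) (hm : 2 ≤ m) :
    ∃ e ∈ Ioo (0:ℝ) 1, deriv (coefA m) e + deriv (coefB m) e < 0 := by
  have hm0 : m ≠ 0 := by omega
  have hm' : (0 : ℝ) < m := by exact_mod_cast Nat.pos_of_ne_zero hm0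
  obtain ⟨e0, hP, h0, h1, -⟩ := ((P_pos_ev m hm).and (small_ev m)).exists
  have hc : ContinuousOn (fun e => coefA m e + coefB m e) (Icc e0 1) := by
    intro y hy
    have hy0 : y ≠ 0 := (lt_of_lt_of_le h0 hy.1).ne'
    have c1 := (uu_hd m hy0).continuousAt
    have c2 := (ww_hd m hm0 hy0).continuousAt
    have c3 := (pref_hd m hm0 hy0).continuousAt
    apply ContinuousAt.continuousWithinAt
    simp only [coefA_eq, coefB_eq]
    exact (c3.mul (by fun_prop)).add (c3.mul (by fun_prop))
  have hsub : ∀ x ∈ Ioo e0 1, x ∈ Ioo (0:ℝ) 1 := fun x hx => ⟨h0.trans hx.1, hx.2⟩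
  have hd : ∀ x ∈ Ioo e0 1, HasDerivAt (fun e => coefA m e + coefB m e)
      (deriv (coefA m) x + deriv (coefB m) x) x := by
    intro x hx
    have hf := e_facts (hsub x hx)
    exact (coefA_hd m hm0 hf.1).differentiableAt.hasDerivAt.add
      (coefB_hd m hm0 hf.1 hf.2.1).differentiableAt.hasDerivAt
  obtain ⟨ξ, hξ, hs⟩ := exists_hasDerivAt_eq_slope _ _ h1 hc hd
  refine ⟨ξ, hsub ξ hξ, ?_⟩
  rw [hs]
  apply div_neg_of_neg_of_pos _ (by linarith)
  have hu := (uw_pos m hm0 one_pos le_rfl).1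
  have : coefA m 1 + coefB m 1 = -(4 / (m:ℝ) ^ 2 * uu m 1) := by
    rw [coefA_eq, coefB_eq]; simp
  have h4 : 0 < 4 / (m:ℝ) ^ 2 * uu m 1 := by positivity
  linarith

lemma Phi_one (m : ℕ) (c : ℝ) : Phi m c 1 = 2 * (1 - c) * ww m 1 := by
  simp [Phi, aa, bb]

lemma zero_of_Phi (m : ℕ) (hm : m ≠ 0) (c : ℝ) {a b : ℝ} (ha : 0 < a) (hab : a ≤ b) (hb : b ≤ 1)
    (h : (0 < Phi m c a ∧ Phi m c b < 0) ∨ (Phi m c a < 0 ∧ 0 < Phi m c b)) :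
    ∃ e ∈ Ioo (0:ℝ) 1, (deriv (coefA m) e + deriv (coefB m) e) +
      c * (deriv (coefA m) e - deriv (coefB m) e) = 0 := by
  have hc : ContinuousOn (Phi m c) (Icc a b) := fun y hy =>
    (Phi_cont m hm c (lt_of_lt_of_le ha hy.1).ne').continuousWithinAt
  have : ∃ e ∈ Ioo a b, Phi m c e = 0 := by
    rcases h with h | h
    · obtain ⟨e, he, h0⟩ := intermediate_value_Ioo' hab hc ⟨h.2, h.1⟩
      exact ⟨e, he, h0⟩
    · obtain ⟨e, he, h0⟩ := intermediate_value_Ioo hab hc ⟨h.1, h.2⟩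
      exact ⟨e, he, h0⟩
  obtain ⟨e, he, h0⟩ := this
  have he' : e ∈ Ioo (0:ℝ) 1 := ⟨ha.trans he.1, lt_of_lt_of_le he.2 hb⟩
  exact ⟨e, he', by rw [h_eq m hm c he', h0, mul_zero]⟩

lemma exists_zero (m : ℕ) (hm : 2 ≤ m) {k : ℝ} (hk : 0 < k) (hk1 : k ≠ 1) :
    ∃ c, (c = k ∨ c = -k) ∧ ∃ e ∈ Ioo (0:ℝ) 1, (deriv (coefA m) e + deriv (coefB m) e) +
      c * (deriv (coefA m) e - deriv (coefB m) e) = 0 := by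
  have hm0 : m ≠ 0 := by omega
  have hw := (uw_pos m hm0 one_pos le_rfl).2
  rcases Nat.lt_or_ge 2 m with h3 | h2
  · rcases lt_or_gt_of_ne hk1 with hlt | hgt
    · obtain ⟨b, hb, hPb⟩ := P_neg_exists m hm
      have hex : ∃ c, (c = k ∨ c = -k) ∧ c * (deriv (coefA m) b - deriv (coefB m) b) ≤ 0 := by
        rcases le_total (deriv (coefA m) b - deriv (coefB m) b) 0 with h | h
        · exact ⟨k, Or.inl rfl, mul_nonpos_of_nonneg_of_nonpos hk.le h⟩
        · exact ⟨-k, Or.inr rfl, mul_nonpos_of_nonpos_of_nonneg (by linarith) h⟩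
      obtain ⟨c, hck, hc⟩ := hex
      refine ⟨c, hck, ?_⟩
      obtain ⟨a, ha, ha0, hab⟩ := ((Phi_pos_ev m h3 c).and ((small_ev m).and
        (nhdsWithin_le_nhds (Iio_mem_nhds hb.1) : ∀ᶠ y in nhdsWithin 0 (Ioi 0), y < b))).exists
      refine zero_of_Phi m hm0 c ha0.1 hab.le hb.2.le (Or.inl ⟨ha, ?_⟩)
      have := h_eq m hm0 c hb
      by_contra hneg
      push Not at hneg
      have := mul_nonneg (h_pref_pos m hm0 hb).le hneg
      linarith
    · obtain ⟨a, ha, ha0⟩ := ((Phi_pos_ev m h3 k).and (small_ev m)).exists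
      refine ⟨k, Or.inl rfl, zero_of_Phi m hm0 k ha0.1 ha0.2.1.le le_rfl (Or.inl ⟨ha, ?_⟩)⟩
      rw [Phi_one]
      exact mul_neg_of_neg_of_pos (by linarith) hw
  · obtain rfl : m = 2 := by omega
    obtain ⟨a, ha, ha0⟩ := ((Phi_neg_ev (-k)).and (small_ev 2)).exists
    refine ⟨-k, Or.inr rfl, zero_of_Phi 2 hm0 (-k) ha0.1 ha0.2.1.le le_rfl (Or.inr ⟨ha, ?_⟩)⟩
    rw [Phi_one]
    exact mul_pos (by linarith) hw

/-- Abstract nondegeneracy. -/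
def goodG (P Q P1 Q1 : ℝ → ℝ) (c : ℝ) : Prop :=
  ∃ e ∈ Ioo (0:ℝ) 1, P1 e + c * Q1 e = 0 ∧ deriv P1 e + c * deriv Q1 e ≠ 0 ∧ P e ≠ 0 ∧ Q e ≠ 0

lemma countable_simple_zeros {f : ℝ → ℝ} {f' : ℝ → ℝ} {S : Set ℝ}
    (h : ∀ e ∈ S, HasDerivAt f (f' e) e ∧ f e = 0 ∧ f' e ≠ 0) : S.Countable := by
  have : DiscreteTopology S := by
    rw [discreteTopology_subtype_iff]
    intro x hx
    obtain ⟨h1, h2, h3⟩ := h x hx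
    have := h1.eventually_ne (c := 0) h3
    rw [Filter.inf_principal_eq_bot]
    filter_upwards [this] with y hy hyS
    exact hy (h y hyS).2.1
  exact Set.countable_coe_iff.1 countable_of_Lindelof_of_discrete

lemma contAt_deriv {f : ℝ → ℝ} {e : ℝ} (h : ContDiffAt ℝ 1 f e) : ContinuousAt (deriv f) e := by
  have h1 : ContinuousAt (fun x => fderiv ℝ f x) e := h.continuousAt_fderiv (by norm_num)
  have h2 : deriv f = fun x => fderiv ℝ f x 1 := by ext x; simp
  rw [h2]
  exact h1.clm_apply continuousAt_const

lemma goodG_open {P Q P1 Q1 : ℝ → ℝ}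
    (hP : ∀ e ∈ Ioo (0:ℝ) 1, HasDerivAt P (P1 e) e)
    (hQ : ∀ e ∈ Ioo (0:ℝ) 1, HasDerivAt Q (Q1 e) e)
    (hP1 : ∀ e ∈ Ioo (0:ℝ) 1, ContDiffAt ℝ 1 P1 e)
    (hQ1 : ∀ e ∈ Ioo (0:ℝ) 1, ContDiffAt ℝ 1 Q1 e) :
    IsOpen {c | goodG P Q P1 Q1 c} := by
  rw [isOpen_iff_mem_nhds]
  rintro c ⟨e, he, h1, h2, h3, h4⟩
  by_cases hq : Q1 e = 0
  · have hp : P1 e = 0 := by rw [hq] at h1; linarith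
    have : ∀ᶠ c' in nhds c, deriv P1 e + c' * deriv Q1 e ≠ 0 :=
      ContinuousAt.eventually_ne (by fun_prop) h2
    filter_upwards [this] with c' hc'
    exact ⟨e, he, by rw [hq, hp]; ring, hc', h3, h4⟩
  · have sP : HasStrictDerivAt P1 (deriv P1 e) e := (hP1 e he).hasStrictDerivAt (by norm_num)
    have sQ : HasStrictDerivAt Q1 (deriv Q1 e) e := (hQ1 e he).hasStrictDerivAt (by norm_num)
    have hR : HasStrictDerivAt (fun x => -(P1 x / Q1 x))
        (-((deriv P1 e * Q1 e - P1 e * deriv Q1 e) / Q1 e ^ 2)) e := (sP.div sQ hq).neg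
    have hc : c = -(P1 e / Q1 e) := by field_simp; linarith
    have hne : -((deriv P1 e * Q1 e - P1 e * deriv Q1 e) / Q1 e ^ 2) ≠ 0 := by
      intro h
      apply h2
      have : P1 e = -(c * Q1 e) := by linarith
      rw [this] at h
      field_simp at h
      linarith
    have hm := hR.map_nhds_eq hne
    simp only [← hc] at hm
    rw [← hm]
    rw [Filter.mem_map]
    have cP1 := (hP1 e he).continuousAt
    have cQ1 := (hQ1 e he).continuousAt
    have cP2 := contAt_deriv (hP1 e he)
    have cQ2 := contAt_deriv (hQ1 e he)
    have e1 : ∀ᶠ x in nhds e, deriv P1 x + (-(P1 x / Q1 x)) * deriv Q1 x ≠ 0 := by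
      refine ContinuousAt.eventually_ne ?_ (by rw [← hc]; exact h2)
      exact cP2.add ((cP1.div cQ1 hq).neg.mul cQ2)
    filter_upwards [e1, cQ1.eventually_ne hq, (hP e he).continuousAt.eventually_ne h3,
      (hQ e he).continuousAt.eventually_ne h4, isOpen_Ioo.mem_nhds he] with x x1 x2 x3 x4 x5
    refine ⟨x, x5, ?_, x1, x3, x4⟩
    field_simp
    ring

open MeasureTheory in
lemma bad_null {P Q P1 Q1 : ℝ → ℝ}
    (hP : ∀ e ∈ Ioo (0:ℝ) 1, HasDerivAt P (P1 e) e)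
    (hQ : ∀ e ∈ Ioo (0:ℝ) 1, HasDerivAt Q (Q1 e) e)
    (hP1 : ∀ e ∈ Ioo (0:ℝ) 1, ContDiffAt ℝ 1 P1 e)
    (hQ1 : ∀ e ∈ Ioo (0:ℝ) 1, ContDiffAt ℝ 1 Q1 e)
    (hcm : ∀ e ∈ Ioo (0:ℝ) 1, P1 e = 0 → Q1 e = 0 →
      P e ≠ 0 ∧ Q e ≠ 0 ∧ (deriv P1 e ≠ 0 ∨ deriv Q1 e ≠ 0)) :
    volume {c : ℝ | c ≠ 0 ∧ ¬ goodG P Q P1 Q1 c ∧ ∃ e ∈ Ioo (0:ℝ) 1, P1 e + c * Q1 e = 0} = 0 := by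
  have dP1 : ∀ e ∈ Ioo (0:ℝ) 1, HasDerivAt P1 (deriv P1 e) e := fun e he =>
    ((hP1 e he).differentiableAt (by norm_num)).hasDerivAt
  have dQ1 : ∀ e ∈ Ioo (0:ℝ) 1, HasDerivAt Q1 (deriv Q1 e) e := fun e he =>
    ((hQ1 e he).differentiableAt (by norm_num)).hasDerivAt
  set R : ℝ → ℝ := fun x => -(P1 x / Q1 x) with hRdef
  set R2 : ℝ → ℝ := fun x => -(deriv P1 x / deriv Q1 x) with hR2def
  set S1 : Set ℝ := {e | e ∈ Ioo (0:ℝ) 1 ∧ Q1 e ≠ 0 ∧ deriv P1 e * Q1 e - P1 e * deriv Q1 e = 0}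
  set S2 : Set ℝ := {e | e ∈ Ioo (0:ℝ) 1 ∧ P e = 0 ∧ P1 e ≠ 0}
  set S3 : Set ℝ := {e | e ∈ Ioo (0:ℝ) 1 ∧ Q e = 0 ∧ Q1 e ≠ 0}
  set S4 : Set ℝ := {e | e ∈ Ioo (0:ℝ) 1 ∧ P1 e = 0 ∧ deriv P1 e ≠ 0}
  set S5 : Set ℝ := {e | e ∈ Ioo (0:ℝ) 1 ∧ Q1 e = 0 ∧ deriv Q1 e ≠ 0}
  have n1 : volume (R '' S1) = 0 := by
    refine addHaar_image_eq_zero_of_det_fderivWithin_eq_zero (f' := fun _ => 0) volume ?_ ?_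
    · rintro e ⟨he, h1, h2⟩
      have := ((dP1 e he).div (dQ1 e he) h1).neg
      rw [h2] at this
      have h3 := this.hasFDerivAt.hasFDerivWithinAt (s := S1)
      refine h3.congr_fderiv ?_
      ext; simp
    · intro x _
      simp
  have c2 : S2.Countable := countable_simple_zeros (f := P) (f' := P1)
    (fun e h => ⟨hP e h.1, h.2.1, h.2.2⟩)
  have c3 : S3.Countable := countable_simple_zeros (f := Q) (f' := Q1)
    (fun e h => ⟨hQ e h.1, h.2.1, h.2.2⟩)
  have c4 : S4.Countable := countable_simple_zeros (f := P1) (f' := deriv P1)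
    (fun e h => ⟨dP1 e h.1, h.2.1, h.2.2⟩)
  have c5 : S5.Countable := countable_simple_zeros (f := Q1) (f' := deriv Q1)
    (fun e h => ⟨dQ1 e h.1, h.2.1, h.2.2⟩)
  have cc : (R '' S2 ∪ R '' S3 ∪ R2 '' S4 ∪ R2 '' S5).Countable :=
    (((c2.image R).union (c3.image R)).union (c4.image R2)).union (c5.image R2)
  refine measure_mono_null ?_ (measure_union_null n1 (cc.measure_zero volume))
  rintro c ⟨hc0, hng, e, he, h⟩
  have hng' : ¬ (deriv P1 e + c * deriv Q1 e ≠ 0 ∧ P e ≠ 0 ∧ Q e ≠ 0) :=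
    fun h' => hng ⟨e, he, h, h'.1, h'.2.1, h'.2.2⟩
  by_cases hq : Q1 e = 0
  · have hp : P1 e = 0 := by rw [hq] at h; linarith
    obtain ⟨a1, a2, a3⟩ := hcm e he hp hq
    have h2 : deriv P1 e + c * deriv Q1 e = 0 := by
      by_contra h2
      exact hng' ⟨h2, a1, a2⟩
    have hq2 : deriv Q1 e ≠ 0 := by
      rcases a3 with a3 | a3
      · intro h3
        rw [h3] at h2
        apply a3; linarith
      · exact a3
    refine Or.inr (Or.inr ⟨e, ⟨he, hq, hq2⟩, ?_⟩)
    simp only [hR2def]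
    field_simp
    linarith
  · have hcR : R e = c := by
      simp only [hRdef]
      field_simp
      linarith
    by_cases h2 : deriv P1 e + c * deriv Q1 e = 0
    · refine Or.inl ⟨e, ⟨he, hq, ?_⟩, hcR⟩
      linear_combination Q1 e * h2 - deriv Q1 e * h
    · by_cases h3 : P e = 0
      · refine Or.inr (Or.inl (Or.inl (Or.inl ⟨e, ⟨he, h3, ?_⟩, hcR⟩)))
        intro h4
        rw [h4, zero_add] at h
        rcases mul_eq_zero.1 h with h | h
        · exact hc0 h
        · exact hq h
      · have h4 : Q e = 0 := by
          by_contra h4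
          exact hng' ⟨h2, h3, h4⟩
        exact Or.inr (Or.inl (Or.inl (Or.inr ⟨e, ⟨he, h4, hq⟩, hcR⟩)))

lemma bes_contDiff (k : ℕ) : ∀ n : ℤ, ContDiff ℝ k (besselJ n) := by
  induction k with
  | zero =>
    intro n
    exact contDiff_zero.2 (continuous_iff_continuousAt.2 fun x => (bes_hasDerivAt n x).continuousAt)
  | succ k ih =>
    intro n
    rw [Nat.cast_add_one, contDiff_succ_iff_deriv]
    refine ⟨fun x => (bes_hasDerivAt n x).differentiableAt, by simp, ?_⟩
    have : deriv (besselJ n) = fun x => (besselJ (n-1) x - besselJ (n+1) x)/2 :=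
      funext fun x => (bes_hasDerivAt n x).deriv
    rw [this]
    exact ((ih _).sub (ih _)).div_const 2

lemma uu_cd (m : ℕ) : ContDiff ℝ 1 (uu m) := by
  have := bes_contDiff 1 m
  unfold uu
  exact this.comp (contDiff_const.mul contDiff_id)

lemma ww_cd (m : ℕ) : ContDiff ℝ 1 (ww m) := by
  have : ContDiff ℝ 1 (besselJd m) := by
    have h : besselJd m = fun x => (besselJ (m-1) x - besselJ (m+1) x)/2 :=
      funext fun x => (bes_hasDerivAt m x).deriv
    rw [h]
    exact ((bes_contDiff 1 _).sub (bes_contDiff 1 _)).div_const 2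
  unfold ww
  exact contDiff_id.mul (this.comp (contDiff_const.mul contDiff_id))

lemma A1_cd (m : ℕ) (hm : m ≠ 0) {e : ℝ} (he : e ∈ Ioo (0:ℝ) 1) :
    ContDiffAt ℝ 1 (deriv (coefA m)) e := by
  have hm' : (m : ℝ) ≠ 0 := by exact_mod_cast hm
  have hev : deriv (coefA m) =ᶠ[nhds e] fun e => 4 / ((m:ℝ) ^ 2 * e ^ 3) * aa m e := by
    filter_upwards [isOpen_Ioo.mem_nhds he] with x hx using A1_eq m hm hx
  refine ContDiffAt.congr_of_eventuallyEq ?_ hev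
  have h2 : (m:ℝ) ^ 2 * e ^ 3 ≠ 0 := mul_ne_zero (pow_ne_zero _ hm') (pow_ne_zero _ (e_facts he).1)
  have hu := (uu_cd m).contDiffAt (x := e)
  have hw := (ww_cd m).contDiffAt (x := e)
  refine ContDiffAt.mul (ContDiffAt.div contDiffAt_const (by fun_prop) h2) ?_
  unfold aa
  fun_prop

lemma B1_cd (m : ℕ) (hm : m ≠ 0) {e : ℝ} (he : e ∈ Ioo (0:ℝ) 1) :
    ContDiffAt ℝ 1 (deriv (coefB m)) e := by
  have hm' : (m : ℝ) ≠ 0 := by exact_mod_cast hm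
  have hev : deriv (coefB m) =ᶠ[nhds e]
      fun e => 8 / ((m:ℝ) ^ 2 * e ^ 3 * Real.sqrt (1 - e ^ 2)) * bb m e := by
    filter_upwards [isOpen_Ioo.mem_nhds he] with x hx using B1_eq m hm hx
  refine ContDiffAt.congr_of_eventuallyEq ?_ hev
  have h2 : (m:ℝ) ^ 2 * e ^ 3 * Real.sqrt (1 - e ^ 2) ≠ 0 :=
    mul_ne_zero (mul_ne_zero (pow_ne_zero _ hm') (pow_ne_zero _ (e_facts he).1))
      (Real.sqrt_pos.2 (e_facts he).2.1).ne'
  have hu := (uu_cd m).contDiffAt (x := e)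
  have hw := (ww_cd m).contDiffAt (x := e)
  have hs : ContDiffAt ℝ 1 (fun e : ℝ => Real.sqrt (1 - e ^ 2)) e :=
    ContDiffAt.sqrt (by fun_prop) (e_facts he).2.1.ne'
  refine ContDiffAt.mul (ContDiffAt.div contDiffAt_const (ContDiffAt.mul (by fun_prop) hs) h2) ?_
  unfold bb
  fun_prop

/-- `A' + B'`. -/
noncomputable def fP1 (m : ℕ) (e : ℝ) : ℝ := deriv (coefA m) e + deriv (coefB m) e
/-- `A' - B'`. -/
noncomputable def fQ1 (m : ℕ) (e : ℝ) : ℝ := deriv (coefA m) e - deriv (coefB m) e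
/-- `A + B`. -/
noncomputable def fP (m : ℕ) (e : ℝ) : ℝ := coefA m e + coefB m e
/-- `A - B`. -/
noncomputable def fQ (m : ℕ) (e : ℝ) : ℝ := coefA m e - coefB m e

lemma fP_hd (m : ℕ) (hm : m ≠ 0) : ∀ e ∈ Ioo (0:ℝ) 1, HasDerivAt (fP m) (fP1 m e) e := by
  intro e he
  have h1 := (coefA_hd m hm (e_facts he).1).differentiableAt.hasDerivAt
  have h2 := (coefB_hd m hm (e_facts he).1 (e_facts he).2.1).differentiableAt.hasDerivAt
  exact h1.add h2

lemma fQ_hd (m : ℕ) (hm : m ≠ 0) : ∀ e ∈ Ioo (0:ℝ) 1, HasDerivAt (fQ m) (fQ1 m e) e := by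
  intro e he
  have h1 := (coefA_hd m hm (e_facts he).1).differentiableAt.hasDerivAt
  have h2 := (coefB_hd m hm (e_facts he).1 (e_facts he).2.1).differentiableAt.hasDerivAt
  exact h1.sub h2

lemma fP1_cd (m : ℕ) (hm : m ≠ 0) : ∀ e ∈ Ioo (0:ℝ) 1, ContDiffAt ℝ 1 (fP1 m) e :=
  fun _ he => (A1_cd m hm he).add (B1_cd m hm he)

lemma fQ1_cd (m : ℕ) (hm : m ≠ 0) : ∀ e ∈ Ioo (0:ℝ) 1, ContDiffAt ℝ 1 (fQ1 m) e :=
  fun _ he => (A1_cd m hm he).sub (B1_cd m hm he)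

lemma f_common (m : ℕ) (hm : 2 ≤ m) : ∀ e ∈ Ioo (0:ℝ) 1, fP1 m e = 0 → fQ1 m e = 0 →
      fP m e ≠ 0 ∧ fQ m e ≠ 0 ∧ (deriv (fP1 m) e ≠ 0 ∨ deriv (fQ1 m) e ≠ 0) := by
  intro e he hp hq
  have hm0 : m ≠ 0 := by omega
  have hm' : (m : ℝ) ≠ 0 := by exact_mod_cast hm0
  have hm2 : (2:ℝ) ≤ m := by exact_mod_cast hm
  obtain ⟨he0, hy, hy1⟩ := e_facts he
  obtain ⟨hu, hw⟩ := uw_pos m hm0 he.1 he.2.le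
  have hs := Real.sqrt_pos.2 hy
  have hss : Real.sqrt (1 - e ^ 2) ^ 2 = 1 - e ^ 2 := Real.sq_sqrt hy.le
  unfold fP1 at hp
  unfold fQ1 at hq
  have hA : deriv (coefA m) e = 0 := by linarith
  have hB : deriv (coefB m) e = 0 := by linarith
  rw [A1_eq m hm0 he] at hA
  rw [B1_eq m hm0 he] at hB
  have ha : aa m e = 0 := (mul_eq_zero.1 hA).resolve_left (by positivity)
  have hb : bb m e = 0 := (mul_eq_zero.1 hB).resolve_left (by positivity)
  have hpre : (4 / ((m:ℝ) ^ 2 * e ^ 2)) ≠ 0 := by positivity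
  have ha' := ha
  have hb' := hb
  unfold aa at ha'
  unfold bb at hb'
  refine ⟨?_, ?_, ?_⟩
  · intro h
    unfold fP at h
    rw [coefA_eq, coefB_eq, ← mul_add] at h
    have h := (mul_eq_zero.1 h).resolve_left hpre
    exact alg_common1 (d := 1) hy hy1 hu hw ha' hb' hss (by norm_num) (by linarith)
  · intro h
    unfold fQ at h
    rw [coefA_eq, coefB_eq, ← mul_sub] at h
    have h := (mul_eq_zero.1 h).resolve_left hpre
    exact alg_common1 (d := -1) hy hy1 hu hw ha' hb' hss (by norm_num) (by linarith)
  · by_contra hcon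
    push Not at hcon
    obtain ⟨h1, h2⟩ := hcon
    have d1 : deriv (fP1 m) e = deriv (deriv (coefA m)) e + deriv (deriv (coefB m)) e :=
      ((A1_diff m hm0 he).hasDerivAt.add (B1_diff m hm0 he).hasDerivAt).deriv
    have d2 : deriv (fQ1 m) e = deriv (deriv (coefA m)) e - deriv (deriv (coefB m)) e :=
      ((A1_diff m hm0 he).hasDerivAt.sub (B1_diff m hm0 he).hasDerivAt).deriv
    have h3 : deriv (deriv (coefA m)) e = 0 := by linarith
    rw [A2_eq m hm0 he ha, (aa_hd m hm0 he0).deriv] at h3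
    have h4 := (mul_eq_zero.1 h3).resolve_left (by positivity)
    have h5 := (div_eq_zero_iff.1 h4).resolve_right he0
    exact alg_common2 hm2 hy hy1 hu hw ha' hb' h5

/-- Good parameter. -/
def goodC (m : ℕ) (c : ℝ) : Prop := goodG (fP m) (fQ m) (fP1 m) (fQ1 m) c

lemma goodC_open (m : ℕ) (hm : m ≠ 0) : IsOpen {c | goodC m c} :=
  goodG_open (fP_hd m hm) (fQ_hd m hm) (fP1_cd m hm) (fQ1_cd m hm)

open MeasureTheory in
lemma badC_null (m : ℕ) (hm : 2 ≤ m) :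
    volume {k : ℝ | 0 < k ∧ ¬ (goodC m k ∨ goodC m (-k))} = 0 := by
  have hm0 : m ≠ 0 := by omega
  have hB := bad_null (fP_hd m hm0) (fQ_hd m hm0) (fP1_cd m hm0) (fQ1_cd m hm0) (f_common m hm)
  set B : Set ℝ := {c : ℝ | c ≠ 0 ∧ ¬ goodG (fP m) (fQ m) (fP1 m) (fQ1 m) c ∧
    ∃ e ∈ Ioo (0:ℝ) 1, fP1 m e + c * fQ1 m e = 0}
  have hB' : volume (-B) = 0 := by rw [Measure.measure_neg]; exact hB
  have h1 : volume ({1} : Set ℝ) = 0 := by simp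
  refine measure_mono_null ?_ (measure_union_null h1 (measure_union_null hB hB'))
  rintro k ⟨hk, hn⟩
  push Not at hn
  by_cases hk1 : k = 1
  · exact Or.inl hk1
  · obtain ⟨c, hc, e, he, h⟩ := exists_zero m hm hk hk1
    rcases hc with rfl | rfl
    · exact Or.inr (Or.inl ⟨hk.ne', hn.1, e, he, h⟩)
    · refine Or.inr (Or.inr ?_)
      exact ⟨by simpa using hk.ne', hn.2, e, he, h⟩

lemma exists_angles (m : ℕ) (hm : m ≠ 0) (σ τ s : ℝ) (hs : s = 1 ∨ s = -1) :
    ∃ ℓ ∈ Ico (0:ℝ) (2 * π), ∃ g ∈ Ico (0:ℝ) (2 * π),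
      Real.cos (2 * g + m * ℓ + τ) = 0 ∧ Real.sin (2 * g + m * ℓ + τ) = 1 ∧
      Real.cos (2 * g - m * ℓ + σ) = 0 ∧ Real.sin (2 * g - m * ℓ + σ) = s := by
  have hm' : (m : ℝ) ≠ 0 := by exact_mod_cast hm
  set g0 : ℝ := ((π / 2 - τ) + (s * (π / 2) - σ)) / 4 with hg0
  set l0 : ℝ := ((π / 2 - τ) - (s * (π / 2) - σ)) / (2 * m) with hl0
  have hml : (m : ℝ) * l0 = ((π / 2 - τ) - (s * (π / 2) - σ)) / 2 := by
    rw [hl0]; field_simp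
  have hl := toIcoMod_mem_Ico Real.two_pi_pos 0 l0
  have hg := toIcoMod_mem_Ico Real.two_pi_pos 0 g0
  rw [zero_add] at hl hg
  refine ⟨_, hl, _, hg, ?_⟩
  unfold toIcoMod
  generalize toIcoDiv Real.two_pi_pos 0 l0 = a
  generalize toIcoDiv Real.two_pi_pos 0 g0 = b
  have e1 : 2 * (g0 - b • (2 * π)) + m * (l0 - a • (2 * π)) + τ
      = π / 2 - ((2 * b + m * a : ℤ) : ℝ) * (2 * π) := by
    simp only [zsmul_eq_mul]
    push_cast
    linear_combination hml + 2 * hg0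
  have e2 : 2 * (g0 - b • (2 * π)) - m * (l0 - a • (2 * π)) + σ
      = s * (π / 2) - ((2 * b - m * a : ℤ) : ℝ) * (2 * π) := by
    simp only [zsmul_eq_mul]
    push_cast
    linear_combination -hml + 2 * hg0
  rw [e1, e2, Real.cos_sub_int_mul_two_pi, Real.sin_sub_int_mul_two_pi,
    Real.cos_sub_int_mul_two_pi, Real.sin_sub_int_mul_two_pi]
  rcases hs with rfl | rfl <;> simp

lemma exists_polar {r x y : ℝ} (hr : 0 < r) (h : r ^ 2 = x ^ 2 + y ^ 2) :
    ∃ t : ℝ, r * Real.cos t = x ∧ r * Real.sin t = y := by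
  have hn : ‖(⟨x, y⟩ : ℂ)‖ = r := by
    rw [Complex.norm_def, Complex.normSq_mk, ← Real.sqrt_sq hr.le]
    congr 1; rw [h]; ring
  refine ⟨Complex.arg ⟨x, y⟩, ?_, ?_⟩
  · rw [← hn, Complex.norm_mul_cos_arg]
  · rw [← hn, Complex.norm_mul_sin_arg]

lemma solve_good (m : ℕ) (hm : 2 ≤ m) (α β ρ s : ℝ) (hs : s = 1 ∨ s = -1)
    (hE : 0 < calE α β ρ) (hF : 0 < calF α β ρ)
    (hg : goodC m (s * (calE α β ρ / calF α β ρ))) :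
    ∃ σ τ : ℝ,
        calE α β ρ * Real.cos σ = β * Real.cos ρ ∧
        calE α β ρ * Real.sin σ = α + β * Real.sin ρ ∧
        calF α β ρ * Real.cos τ = β * Real.cos ρ ∧
        calF α β ρ * Real.sin τ = α - β * Real.sin ρ ∧
        ∃ p ∈ bifSolSet m α β ρ σ τ, bifJac m α β ρ σ τ p.1 p.2.1 p.2.2 ≠ 0 := by
  have hm0 : m ≠ 0 := by omega
  have hm' : (m : ℝ) ≠ 0 := by exact_mod_cast hm0
  have hE2 : calE α β ρ ^ 2 = (β * Real.cos ρ) ^ 2 + (α + β * Real.sin ρ) ^ 2 := by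
    have h0 := Real.sqrt_pos.1 hE
    unfold calE
    rw [Real.sq_sqrt h0.le]
    linear_combination -β ^ 2 * Real.sin_sq_add_cos_sq ρ
  have hF2 : calF α β ρ ^ 2 = (β * Real.cos ρ) ^ 2 + (α - β * Real.sin ρ) ^ 2 := by
    have h0 := Real.sqrt_pos.1 hF
    unfold calF
    rw [Real.sq_sqrt h0.le]
    linear_combination -β ^ 2 * Real.sin_sq_add_cos_sq ρ
  obtain ⟨σ, s1, s2⟩ := exists_polar hE hE2
  obtain ⟨τ, t1, t2⟩ := exists_polar hF hF2
  refine ⟨σ, τ, s1, s2, t1, t2, ?_⟩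
  obtain ⟨ℓ, hl, g, hg', c1, i1, c2, i2⟩ := exists_angles m hm0 σ τ s hs
  obtain ⟨e, he, h1, h2, h3, h4⟩ := hg
  have hs0 : s ≠ 0 := by rcases hs with rfl | rfl <;> norm_num
  refine ⟨(e, ℓ, g), ⟨he, hl, hg', ?_, ?_, ?_⟩, ?_⟩
  · simp [bifF1, c1]
  · simp [bifF2, c2]
  · simp only [bifF3, i1, i2]
    unfold fP1 fQ1 at h1
    field_simp at h1
    linear_combination h1
  · set E := calE α β ρ with hEd
    set F := calF α β ρ with hFd
    have lin1 : ∀ x : ℝ, HasDerivAt (fun x : ℝ => 2 * g + m * x + τ) m x := fun x => by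
      simpa using (((hasDerivAt_id x).const_mul (m:ℝ)).const_add (2 * g)).add_const τ
    have lin2 : ∀ x : ℝ, HasDerivAt (fun x : ℝ => 2 * x + m * ℓ + τ) 2 x := fun x => by
      simpa using (((hasDerivAt_id x).const_mul (2:ℝ)).add_const (m * ℓ)).add_const τ
    have lin3 : ∀ x : ℝ, HasDerivAt (fun x : ℝ => 2 * g - m * x + σ) (-m) x := fun x => by
      simpa using (((hasDerivAt_id x).const_mul (m:ℝ)).const_sub (2 * g)).add_const σ
    have lin4 : ∀ x : ℝ, HasDerivAt (fun x : ℝ => 2 * x - m * ℓ + σ) 2 x := fun x => by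
      simpa using (((hasDerivAt_id x).const_mul (2:ℝ)).sub_const (m * ℓ)).add_const σ
    have d11 : deriv (fun x => bifF1 m α β ρ τ x ℓ g) e = 0 := by simp [bifF1, c1]
    have d21 : deriv (fun x => bifF2 m α β ρ σ x ℓ g) e = 0 := by simp [bifF2, c2]
    have d12 : deriv (fun x => bifF1 m α β ρ τ e x g) ℓ = -(F * fP m e * m) := by
      have := ((lin1 ℓ).cos.const_mul (F * fP m e)).deriv
      rw [i1] at this
      unfold bifF1
      refine this.trans (by ring)
    have d13 : deriv (fun x => bifF1 m α β ρ τ e ℓ x) g = -(F * fP m e * 2) := by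
      have := ((lin2 g).cos.const_mul (F * fP m e)).deriv
      rw [i1] at this
      unfold bifF1
      refine this.trans (by ring)
    have d22 : deriv (fun x => bifF2 m α β ρ σ e x g) ℓ = E * fQ m e * s * m := by
      have := ((lin3 ℓ).cos.const_mul (E * fQ m e)).deriv
      rw [i2] at this
      unfold bifF2
      refine this.trans (by ring)
    have d23 : deriv (fun x => bifF2 m α β ρ σ e ℓ x) g = -(E * fQ m e * s * 2) := by
      have := ((lin4 g).cos.const_mul (E * fQ m e)).deriv
      rw [i2] at this
      unfold bifF2
      refine this.trans (by ring)
    have d31 : deriv (fun x => bifF3 m α β ρ σ τ x ℓ g) e =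
        deriv (fP1 m) e * F + deriv (fQ1 m) e * E * s := by
      have dP := ((fP1_cd m hm0 e he).differentiableAt (by norm_num)).hasDerivAt
      have dQ := ((fQ1_cd m hm0 e he).differentiableAt (by norm_num)).hasDerivAt
      have := ((dP.mul_const F).add ((dQ.mul_const E).mul_const s)).deriv
      simp only [bifF3, i1, i2, mul_one]
      exact this
    have h2' : deriv (fP1 m) e * F + deriv (fQ1 m) e * E * s ≠ 0 := by
      intro h
      apply h2
      have : F ≠ 0 := hF.ne'
      field_simp
      linear_combination h
    unfold bifJac
    rw [Matrix.det_fin_three]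
    simp only [Matrix.of_apply, Matrix.cons_val', Matrix.cons_val_zero, Matrix.cons_val_one,
      Matrix.cons_val, d11, d21, d31, d12, d13, d22, d23]
    have : (4:ℝ) * m * (F * fP m e * (E * fQ m e)) * s *
        (deriv (fP1 m) e * F + deriv (fQ1 m) e * E * s) ≠ 0 := by
      refine mul_ne_zero (mul_ne_zero (mul_ne_zero (mul_ne_zero (by norm_num) hm')
        (mul_ne_zero (mul_ne_zero hF.ne' h3) (mul_ne_zero hE.ne' h4))) hs0) h2'
    intro h
    apply this
    rw [← h]
    ring

/-- The good parameter set. -/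
def goodU (m : ℕ) : Set (ℝ × ℝ × ℝ) :=
  {p | 0 < calE p.1 p.2.1 p.2.2 ∧ 0 < calF p.1 p.2.1 p.2.2 ∧
    (goodC m (calE p.1 p.2.1 p.2.2 / calF p.1 p.2.1 p.2.2) ∨
      goodC m (-(calE p.1 p.2.1 p.2.2 / calF p.1 p.2.1 p.2.2)))}

lemma calE_cont : Continuous (fun p : ℝ × ℝ × ℝ => calE p.1 p.2.1 p.2.2) := by
  unfold calE; fun_prop

lemma calF_cont : Continuous (fun p : ℝ × ℝ × ℝ => calF p.1 p.2.1 p.2.2) := by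
  unfold calF; fun_prop

lemma goodU_open (m : ℕ) (hm : m ≠ 0) : IsOpen (goodU m) := by
  rw [isOpen_iff_mem_nhds]
  rintro p ⟨hE, hF, h⟩
  have cE := calE_cont.continuousAt (x := p)
  have cF := calF_cont.continuousAt (x := p)
  have cK := cE.div cF hF.ne'
  have hO : IsOpen ({c | goodC m c} ∪ (fun x : ℝ => -x) ⁻¹' {c | goodC m c}) :=
    (goodC_open m hm).union ((goodC_open m hm).preimage continuous_neg)
  have h3 := cK.eventually (hO.mem_nhds (show _ from h))
  filter_upwards [cE.eventually (lt_mem_nhds hE), cF.eventually (lt_mem_nhds hF), h3] with q q1 q2 q3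
  exact ⟨q1, q2, q3⟩

lemma null_connected {S : Set ℝ} (h : IsPreconnected S) (h0 : MeasureTheory.volume S = 0) :
    ∀ x ∈ S, ∀ y ∈ S, x = y := by
  have key : ∀ x ∈ S, ∀ y ∈ S, ¬ x < y := by
    intro x hx y hy hxy
    have h1 : Icc x y ⊆ S := h.Icc_subset hx hy
    have h2 := MeasureTheory.measure_mono_null h1 h0
    rw [Real.volume_Icc] at h2
    simp at h2
    linarith
  intro x hx y hy
  exact le_antisymm (not_lt.1 (key y hy x hx)) (not_lt.1 (key x hx y hy))

lemma sin_not_const {a b c : ℝ} (hab : a < b) (h : ∀ x ∈ Ioo a b, Real.sin x = c) : False := by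
  have hc : ∀ x ∈ Ioo a b, Real.cos x = 0 := by
    intro x hx
    have : Real.sin =ᶠ[nhds x] fun _ => c := by
      filter_upwards [isOpen_Ioo.mem_nhds hx] with y hy using h y hy
    have h2 := this.deriv_eq
    simpa using h2
  obtain ⟨x, hx⟩ := nonempty_Ioo.2 hab
  have : Real.cos =ᶠ[nhds x] fun _ => 0 := by
    filter_upwards [isOpen_Ioo.mem_nhds hx] with y hy using hc y hy
  have h2 := this.deriv_eq
  simp at h2
  have := Real.sin_sq_add_cos_sq x
  rw [h2, hc x hx] at this
  norm_num at this

lemma pos_aux {α β s : ℝ} (h1 : α + β ≠ 0) (h2 : α - β ≠ 0) (hs : -1 ≤ s) (hs' : s ≤ 1) :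
    0 < α ^ 2 + β ^ 2 + 2 * α * β * s := by
  have a := sq_pos_of_ne_zero h1
  have b := sq_pos_of_ne_zero h2
  have e : α ^ 2 + β ^ 2 + 2 * α * β * s
      = (1 + s) / 2 * (α + β) ^ 2 + (1 - s) / 2 * (α - β) ^ 2 := by ring
  rw [e]
  rcases le_total 0 s with h | h
  · have : 0 < (1 + s) / 2 * (α + β) ^ 2 := mul_pos (by linarith) a
    have : 0 ≤ (1 - s) / 2 * (α - β) ^ 2 := mul_nonneg (by linarith) b.le
    linarith
  · have : 0 ≤ (1 + s) / 2 * (α + β) ^ 2 := mul_nonneg (by linarith) a.le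
    have : 0 < (1 - s) / 2 * (α - β) ^ 2 := mul_pos (by linarith) b
    linarith

lemma goodU_dense (m : ℕ) (hm : 2 ≤ m) : Dense (goodU m) := by
  rw [Metric.dense_iff]
  rintro ⟨α0, β0, ρ0⟩ ε hε
  have dense1 : Dense (({0} : Set ℝ)ᶜ) := (Set.countable_singleton 0).dense_compl ℝ
  obtain ⟨α, hα, hα0⟩ := Metric.dense_iff.1 dense1 α0 ε hε
  have dense2 : Dense (({0, α, -α} : Set ℝ)ᶜ) := (Set.toFinite _).countable.dense_compl ℝ
  obtain ⟨β, hβ, hβ0⟩ := Metric.dense_iff.1 dense2 β0 ε hε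
  simp only [mem_compl_iff, mem_insert_iff, mem_singleton_iff, not_or] at hα0 hβ0
  obtain ⟨b0, b1, b2⟩ := hβ0
  have hp1 : α + β ≠ 0 := fun h => b2 (by linarith)
  have hp2 : α - β ≠ 0 := fun h => b1 (by linarith)
  have rE : ∀ ρ, 0 < α ^ 2 + β ^ 2 + 2 * α * β * Real.sin ρ := fun ρ =>
    pos_aux hp1 hp2 (Real.neg_one_le_sin ρ) (Real.sin_le_one ρ)
  have rF : ∀ ρ, 0 < α ^ 2 + β ^ 2 - 2 * α * β * Real.sin ρ := fun ρ => by
    have := pos_aux (s := -Real.sin ρ) hp1 hp2 (by linarith [Real.sin_le_one ρ])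
      (by linarith [Real.neg_one_le_sin ρ])
    linarith
  have hE : ∀ ρ, 0 < calE α β ρ := fun ρ => Real.sqrt_pos.2 (rE ρ)
  have hF : ∀ ρ, 0 < calF α β ρ := fun ρ => Real.sqrt_pos.2 (rF ρ)
  by_contra hcon
  rw [Set.not_nonempty_iff_eq_empty] at hcon
  have hbad : ∀ ρ ∈ Ioo (ρ0 - ε) (ρ0 + ε), (α, β, ρ) ∉ goodU m := by
    intro ρ hρ hU
    have : (α, β, ρ) ∈ Metric.ball (α0, β0, ρ0) ε ∩ goodU m := by
      refine ⟨?_, hU⟩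
      rw [← Real.ball_eq_Ioo] at hρ
      rw [Metric.mem_ball] at *
      rw [Prod.dist_eq, Prod.dist_eq]
      exact max_lt hα (max_lt hβ hρ)
    rw [hcon] at this
    exact this
  have cK : Continuous (fun ρ => calE α β ρ / calF α β ρ) := by
    have c1 : Continuous (fun ρ => calE α β ρ) := by unfold calE; fun_prop
    have c2 : Continuous (fun ρ => calF α β ρ) := by unfold calF; fun_prop
    exact c1.div c2 fun ρ => (hF ρ).ne'
  set S := (fun ρ => calE α β ρ / calF α β ρ) '' Ioo (ρ0 - ε) (ρ0 + ε) with hS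
  have hpre : IsPreconnected S := isPreconnected_Ioo.image _ cK.continuousOn
  have hnull : MeasureTheory.volume S = 0 := by
    refine MeasureTheory.measure_mono_null ?_ (badC_null m hm)
    rintro _ ⟨ρ, hρ, rfl⟩
    exact ⟨div_pos (hE ρ) (hF ρ), fun h => hbad ρ hρ ⟨hE ρ, hF ρ, h⟩⟩
  have hconst := null_connected hpre hnull
  refine sin_not_const (a := ρ0 - ε) (b := ρ0 + ε) (c := Real.sin ρ0) (by linarith) ?_
  intro x hx
  have h0 : ρ0 ∈ Ioo (ρ0 - ε) (ρ0 + ε) := ⟨by linarith, by linarith⟩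
  have h := hconst _ ⟨x, hx, rfl⟩ _ ⟨ρ0, h0, rfl⟩
  have h : calE α β x / calF α β x = calE α β ρ0 / calF α β ρ0 := h
  rw [div_eq_div_iff (hF x).ne' (hF ρ0).ne'] at h
  have h' : (calE α β x * calF α β ρ0) ^ 2 = (calE α β ρ0 * calF α β x) ^ 2 := by rw [h]
  rw [mul_pow, mul_pow] at h'
  unfold calE calF at h'
  rw [Real.sq_sqrt (rE x).le, Real.sq_sqrt (rE ρ0).le, Real.sq_sqrt (rF x).le,
    Real.sq_sqrt (rF ρ0).le] at h'
  have h3 : (4 * α * β * (α ^ 2 + β ^ 2)) * (Real.sin x - Real.sin ρ0) = 0 := by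
    linear_combination h'
  have h4 : 4 * α * β * (α ^ 2 + β ^ 2) ≠ 0 := by
    have := sq_pos_of_ne_zero hα0
    exact mul_ne_zero (mul_ne_zero (mul_ne_zero (by norm_num) hα0) b0) (by positivity)
  have := (mul_eq_zero.1 h3).resolve_left h4
  linarith

/-- For every integer `m ≥ 2`, generically relative to the parameters `(α, β, ρ) ∈ ℝ³`,
the bifurcation system (B) for the `(m:1)` resonance has at least one simple solution. -/
theorem stmt_17 (m : ℕ) (hm : 2 ≤ m) :
    ∃ U : Set (ℝ × ℝ × ℝ), IsOpen U ∧ Dense U ∧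
      ∀ α β ρ : ℝ, (α, β, ρ) ∈ U → ∃ σ τ : ℝ,
        calE α β ρ * Real.cos σ = β * Real.cos ρ ∧
        calE α β ρ * Real.sin σ = α + β * Real.sin ρ ∧
        calF α β ρ * Real.cos τ = β * Real.cos ρ ∧
        calF α β ρ * Real.sin τ = α - β * Real.sin ρ ∧
        ∃ p ∈ bifSolSet m α β ρ σ τ, bifJac m α β ρ σ τ p.1 p.2.1 p.2.2 ≠ 0 := by
  refine ⟨goodU m, goodU_open m (by omega), goodU_dense m hm, ?_⟩
  rintro α β ρ ⟨hE, hF, h⟩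
  simp only at hE hF h
  rcases h with h | h
  · exact solve_good m hm α β ρ 1 (Or.inl rfl) hE hF (by rw [one_mul]; exact h)
  · exact solve_good m hm α β ρ (-1) (Or.inr rfl) hE hF (by rw [neg_one_mul]; exact h)
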